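/- arXiv:1903.07083 — 4 statements merged into one kernel-verified Lean document; each statement's English description precedes it below -/
import Mathlib

section
/- For every integer e ≥ 2 and every prime power q, the proportion fat(e) of elements g in GL(e,q) whose characteristic polynomial is irreducible over F_q satisfies 1/(e+1) ≤ fat(e) < 1/e. -/
section

open Polynomial

/-- The pairs of an endomorphism with irreducible characteristic polynomial `f` and a nonzero
vector correspond to the linear equivalences from `F[X] / (f)`. -/
theorem card_charpoly_eq_mul_card_ne_zero {F V : Type*} [Field F] [AddCommGroup V] [Module F V]
    [Module.Finite F V] {f : F[X]} (hm : f.Monic) (hf : Irreducible f)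
    (hd : f.natDegree = Module.finrank F V) :
    Nat.card {T : Module.End F V // T.charpoly = f} * Nat.card {v : V // v ≠ 0} =
      Nat.card (V ≃ₗ[F] V) := by
  have : Fact (Irreducible f) := ⟨hf⟩
  have : Module.Finite F (AdjoinRoot f) := hm.finite_adjoinRoot
  have hrank : Module.finrank F (AdjoinRoot f) = Module.finrank F V := by
    rw [(AdjoinRoot.powerBasis hf.ne_zero).finrank, AdjoinRoot.powerBasis_dim, hd]
  have hroot : (Algebra.lmul F (AdjoinRoot f) (AdjoinRoot.root f)).charpoly = f := by
    have := charpoly_leftMulMatrix (AdjoinRoot.powerBasis hf.ne_zero)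
    rw [AdjoinRoot.powerBasis_gen, AdjoinRoot.minpoly_root hf.ne_zero, hm.leadingCoeff] at this
    rw [← LinearMap.charpoly_toMatrix _ (AdjoinRoot.powerBasis hf.ne_zero).basis]
    simpa [Algebra.leftMulMatrix_apply] using this
  let Φ : (AdjoinRoot f ≃ₗ[F] V) →
      {T : Module.End F V // T.charpoly = f} × {v : V // v ≠ 0} := fun φ ↦
    (⟨φ.conj (Algebra.lmul F (AdjoinRoot f) (AdjoinRoot.root f)), by
      rw [LinearEquiv.charpoly_conj, hroot]⟩, ⟨φ 1, by simp⟩)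
  have hΦ : Function.Bijective Φ := by
    constructor
    · intro φ ψ h
      obtain ⟨h1, h2⟩ := Prod.ext_iff.1 h
      have h1 := Subtype.ext_iff.1 h1
      have h2 : φ 1 = ψ 1 := Subtype.ext_iff.1 h2
      have key (a : AdjoinRoot f) (ha : φ a = ψ a) :
          φ (AdjoinRoot.root f * a) = ψ (AdjoinRoot.root f * a) := by
        have := LinearMap.congr_fun h1 (φ a)
        dsimp only [Φ] at this
        rw [LinearEquiv.conj_apply_apply, LinearEquiv.conj_apply_apply, φ.symm_apply_apply,
          ha, ψ.symm_apply_apply] at this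
        simpa using this
      ext a
      induction a using AdjoinRoot.induction_on with
      | ih p =>
        induction p using Polynomial.induction_on' with
        | add p q hp hq => simp [hp, hq]
        | monomial n c =>
          have hn : φ (AdjoinRoot.root f ^ n) = ψ (AdjoinRoot.root f ^ n) := by
            induction n with
            | zero => simpa using h2
            | succ n ih => rw [pow_succ']; exact key _ ih
          have : AdjoinRoot.mk f (monomial n c) = c • AdjoinRoot.root f ^ n := by
            rw [← C_mul_X_pow_eq_monomial, map_mul, map_pow, AdjoinRoot.mk_X, AdjoinRoot.mk_C,
              Algebra.smul_def, AdjoinRoot.algebraMap_eq]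
          rw [this, map_smul, map_smul, hn]
    · rintro ⟨⟨T, hT⟩, ⟨v, hv⟩⟩
      have h0 : aeval T f = 0 := by rw [← hT, LinearMap.aeval_self_charpoly]
      let ρ : AdjoinRoot f →ₐ[F] Module.End F V :=
        Ideal.Quotient.liftₐ (Ideal.span {f}) (aeval T) fun p hp ↦ by
          obtain ⟨r, rfl⟩ := Ideal.mem_span_singleton.1 hp
          rw [map_mul, h0, zero_mul]
      have hρ : ρ (AdjoinRoot.root f) = T := aeval_X T
      let φ₀ : AdjoinRoot f →ₗ[F] V := (LinearMap.applyₗ v).comp ρ.toLinearMap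
      have hinj : Function.Injective φ₀ := by
        rw [injective_iff_map_eq_zero]
        intro a ha
        by_contra hne
        apply hv
        have h1 : ρ (a⁻¹ * a) v = 0 := by
          rw [map_mul, Module.End.mul_apply]
          change ρ a⁻¹ (φ₀ a) = 0
          rw [ha, map_zero]
        simpa [hne] using h1
      let φ := LinearEquiv.ofInjectiveOfFinrankEq φ₀ hinj hrank
      have hφ (a : AdjoinRoot f) : φ a = ρ a v := rfl
      refine ⟨φ, Prod.ext (Subtype.ext ?_) (Subtype.ext ?_)⟩
      · refine LinearMap.ext fun w ↦ ?_
        obtain ⟨a, rfl⟩ := φ.surjective w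
        dsimp only [Φ]
        rw [LinearEquiv.conj_apply_apply, φ.symm_apply_apply]
        simp [hφ, hρ]
      · change φ 1 = v
        simp [hφ]
  let ψ := LinearEquiv.ofFinrankEq (AdjoinRoot f) V hrank
  rw [← Nat.card_prod, ← Nat.card_eq_of_bijective Φ hΦ]
  exact Nat.card_congr
    ⟨fun φ ↦ ψ.symm.trans φ, fun φ ↦ ψ.trans φ, fun φ ↦ by ext; simp, fun φ ↦ by ext; simp⟩

/-- The monic irreducible polynomials of degree `d`. -/
def monicIrreducibles (F : Type*) [Field F] (d : ℕ) : Set F[X] :=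
  {f | f.Monic ∧ Irreducible f ∧ f.natDegree = d}

theorem monicIrreducibles_finite (F : Type*) [Field F] [Finite F] {d : ℕ} :
    (monicIrreducibles F d).Finite := by
  have hfin : (degreeLT F (d + 1) : Set F[X]).Finite := by
    have := Module.finite_of_finite F (M := degreeLT F (d + 1))
    exact Set.toFinite _
  refine hfin.subset fun f hf ↦ ?_
  rw [SetLike.mem_coe, mem_degreeLT, degree_eq_natDegree hf.2.1.ne_zero, hf.2.2]
  exact_mod_cast d.lt_succ_self

theorem sum_divisors_mul_card_monicIrreducibles (F : Type*) [Field F] [Finite F] {n : ℕ}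
    (hn : n ≠ 0) :
    ∑ d ∈ n.divisors, d * (monicIrreducibles F d).ncard = Nat.card F ^ n := by
  classical
  have := Fintype.ofFinite F
  set p : F[X] := X ^ Nat.card F ^ n - X with hp
  have hp0 : p ≠ 0 := FiniteField.X_pow_card_pow_sub_X_ne_zero F hn Finite.one_lt_card
  have hdeg : p.natDegree = Nat.card F ^ n :=
    FiniteField.X_pow_card_pow_sub_X_natDegree_eq F hn Finite.one_lt_card
  have hpm : p.Monic := by
    apply monic_X_pow_sub
    rw [degree_X]
    exact_mod_cast Nat.one_lt_pow hn Finite.one_lt_card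
  have hsq : Squarefree p := by
    apply Separable.squarefree
    obtain ⟨r, hr⟩ := CharP.exists F
    refine galois_poly_separable r _ ?_
    rw [Nat.card_eq_fintype_card]
    exact dvd_pow ((CharP.cast_eq_zero_iff F r _).1 (FiniteField.cast_card_eq_zero F)) hn
  have hnd := (UniqueFactorizationMonoid.squarefree_iff_nodup_normalizedFactors hp0).1 hsq
  let S := (UniqueFactorizationMonoid.normalizedFactors p).toFinset
  have hS (f : F[X]) : f ∈ S ↔ f.Monic ∧ Irreducible f ∧ f.natDegree ∣ n := by
    rw [Multiset.mem_toFinset, Polynomial.mem_normalizedFactors_iff hp0]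
    constructor
    · rintro ⟨hi, hm, hd⟩
      exact ⟨hm, hi, hi.natDegree_dvd_iff_dvd_X_pow_card_pow_sub_X.2 hd⟩
    · rintro ⟨hm, hi, hd⟩
      exact ⟨hi, hm, hi.natDegree_dvd_iff_dvd_X_pow_card_pow_sub_X.1 hd⟩
  have hprod : ∏ f ∈ S, f = p := by
    have h := UniqueFactorizationMonoid.prod_normalizedFactors_eq hp0
    rw [hpm.normalize_eq_self] at h
    rw [← h, Finset.prod, Multiset.map_id', Multiset.toFinset_val, hnd.dedup]
  have hsum : ∑ f ∈ S, f.natDegree = Nat.card F ^ n := by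
    rw [← hdeg, ← hprod]
    exact (natDegree_prod _ _ fun f hf ↦ ((hS f).1 hf).2.1.ne_zero).symm
  rw [← hsum, ← Finset.sum_fiberwise_of_maps_to (s := S) (t := n.divisors) (g := natDegree)
    fun f hf ↦ Nat.mem_divisors.2 ⟨((hS f).1 hf).2.2, hn⟩]
  refine Finset.sum_congr rfl fun d hd ↦ ?_
  have : monicIrreducibles F d = ({f ∈ S | f.natDegree = d} : Finset F[X]) := by
    ext f
    simp only [monicIrreducibles, Set.mem_ofPred_eq, Finset.coe_filter, hS]
    constructor
    · rintro ⟨h1, h2, rfl⟩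
      exact ⟨⟨h1, h2, Nat.dvd_of_mem_divisors hd⟩, rfl⟩
    · rintro ⟨⟨h1, h2, _⟩, h⟩
      exact ⟨h1, h2, h⟩
  rw [this, Set.ncard_coe_finset, Finset.sum_congr rfl fun f hf ↦ (Finset.mem_filter.1 hf).2,
    Finset.sum_const, smul_eq_mul, mul_comm]

/-- The conclusion depends only on the identity `∑ d ∣ n, d * I d = q ^ n`. -/
theorem bounds_of_sum_divisors {q : ℕ} (hq : 2 ≤ q) {I : ℕ → ℕ}
    (hI : ∀ n, n ≠ 0 → ∑ d ∈ n.divisors, d * I d = q ^ n) {e : ℕ} (he : 2 ≤ e) :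
    q ^ e - 1 ≤ (e + 1) * I e ∧ e * I e < q ^ e - 1 := by
  have hpos : 0 < q ^ e := by positivity
  have hsplit (n : ℕ) (hn : n ≠ 0) : ∑ d ∈ n.properDivisors, d * I d + n * I n = q ^ n := by
    rw [← hI n hn, ← Nat.cons_self_properDivisors hn, Finset.sum_cons, add_comm]
  have hle (n : ℕ) (hn : n ≠ 0) : n * I n ≤ q ^ n := by
    have := hsplit n hn
    omega
  have h1 : 1 * I 1 = q := by simpa using hI 1 one_ne_zero
  have he' := hsplit e (by omega)
  have hproper : q ≤ ∑ d ∈ e.properDivisors, d * I d := by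
    nth_rw 1 [← h1]
    exact Finset.single_le_sum (f := fun d ↦ d * I d) (fun _ _ ↦ Nat.zero_le _)
      (Nat.mem_properDivisors.2 ⟨one_dvd _, by omega⟩)
  refine ⟨?_, by omega⟩
  suffices h : (e + 1) * ∑ d ∈ e.properDivisors, d * I d ≤ q ^ e + e by
    refine Nat.le_of_mul_le_mul_left (c := e) ?_ (by omega)
    zify [hpos] at h he' ⊢
    linear_combination h - (e + 1) * he'
  by_cases hsmall : e ≤ 8 ∧ e ≠ 7
  · have d2 : Nat.properDivisors 2 = {1} := by decide
    have d3 : Nat.properDivisors 3 = {1} := by decide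
    have d4 : Nat.properDivisors 4 = {1, 2} := by decide
    have d5 : Nat.properDivisors 5 = {1} := by decide
    have d6 : Nat.properDivisors 6 = {1, 2, 3} := by decide
    have d8 : Nat.properDivisors 8 = {1, 2, 4} := by decide
    have h2 := hsplit 2 (by omega)
    have h3 := hsplit 3 (by omega)
    have h4 := hsplit 4 (by omega)
    simp only [d2, d3, d4, Finset.sum_singleton, Finset.sum_insert, Finset.mem_singleton,
      OfNat.one_ne_ofNat, not_false_eq_true] at h2 h3 h4
    obtain ⟨t, rfl⟩ := Nat.exists_eq_add_of_le' hq
    obtain ⟨hle8, hne7⟩ := hsmall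
    interval_cases e
    · simp [d2]; nlinarith
    · simp [d3]; nlinarith
    · simp [d4]; nlinarith
    · simp [d5]; nlinarith
    · simp [d6]
      have : 0 ≤ 87 * t + 191 * t ^ 2 + 153 * t ^ 3 + 60 * t ^ 4 + 12 * t ^ 5 + t ^ 6 := by
        positivity
      linarith
    · omega
    · simp [d8]
      have : 0 ≤ t * (736 + 1576 * t + 1720 * t ^ 2 + 1111 * t ^ 3 + 448 * t ^ 4 +
          112 * t ^ 5 + 16 * t ^ 6 + t ^ 7) := by
        positivity
      linarith
  · have hsum : ∑ d ∈ e.properDivisors, d * I d ≤ 2 * q ^ (e / 2) := by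
      calc ∑ d ∈ e.properDivisors, d * I d ≤ ∑ d ∈ Finset.range (e / 2 + 1), q ^ d := by
            refine (Finset.sum_le_sum fun d hd ↦
              hle d (Nat.pos_of_mem_properDivisors hd).ne').trans
              (Finset.sum_le_sum_of_subset fun d hd ↦ ?_)
            obtain ⟨⟨k, rfl⟩, hlt⟩ := Nat.mem_properDivisors.1 hd
            have : 1 < k := by
              by_contra hk
              interval_cases k <;> omega
            rw [Finset.mem_range, Nat.lt_succ_iff, Nat.le_div_iff_mul_le two_pos]
            exact Nat.mul_le_mul_left d this
        _ ≤ 2 * q ^ (e / 2) := by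
            rw [Finset.sum_range_succ]
            have := Nat.geomSum_lt hq (s := Finset.range (e / 2)) (n := e / 2) (by simp)
            omega
    have hpow (m : ℕ) : 2 * (2 * (m + 4) + 1) ≤ 2 ^ (m + 4) ∨ m = 0 := by
      induction m with
      | zero => simp
      | succ m ih =>
        left
        rcases ih with ih | rfl
        · rw [Nat.add_right_comm, pow_succ]
          omega
        · norm_num
    have hpow' : 2 * (e + 1) ≤ q ^ (e - e / 2) := by
      refine le_trans ?_ (Nat.pow_le_pow_left hq _)
      have := hpow (e - e / 2 - 4)
      rw [Nat.sub_add_cancel (by omega)] at this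
      by_cases h7 : e = 7
      · subst h7; norm_num
      · omega
    calc (e + 1) * ∑ d ∈ e.properDivisors, d * I d ≤ (e + 1) * (2 * q ^ (e / 2)) := by gcongr
      _ = 2 * (e + 1) * q ^ (e / 2) := by ring
      _ ≤ q ^ (e - e / 2) * q ^ (e / 2) := by gcongr
      _ = q ^ e := by rw [← pow_add]; congr 1; omega
      _ ≤ q ^ e + e := Nat.le_add_right _ _

theorem card_irreducible_charpoly_mul {F : Type*} [Field F] [Finite F] {e : ℕ} (he : 2 ≤ e) :
    Nat.card {g : GL (Fin e) F // Irreducible ((g : Matrix (Fin e) (Fin e) F).charpoly)} *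
      (Nat.card F ^ e - 1) = (monicIrreducibles F e).ncard * Nat.card (GL (Fin e) F) := by
  have : Finite (monicIrreducibles F e) := monicIrreducibles_finite F
  have : Fintype (monicIrreducibles F e) := Fintype.ofFinite _
  have : Finite (Module.End F (Fin e → F)) := Module.finite_of_finite F
  have hV : Nat.card {v : Fin e → F // v ≠ 0} = Nat.card F ^ e - 1 := by
    change Nat.card ({0}ᶜ : Set (Fin e → F)) = _
    rw [Nat.card_coe_set_eq, Set.ncard_compl, Set.ncard_singleton, Nat.card_fun, Nat.card_fin]
  have hGL : Nat.card ((Fin e → F) ≃ₗ[F] (Fin e → F)) = Nat.card (GL (Fin e) F) :=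
    Nat.card_congr ((LinearMap.GeneralLinearGroup.generalLinearEquiv F (Fin e → F)).symm.trans
      Matrix.GeneralLinearGroup.toLin.symm).toEquiv
  have hGLEnd : Nat.card {g : GL (Fin e) F //
        Irreducible ((g : Matrix (Fin e) (Fin e) F).charpoly)} =
      Nat.card {T : Module.End F (Fin e → F) // Irreducible T.charpoly} := by
    refine Nat.card_eq_of_bijective
      (fun g ↦ ⟨Matrix.toLin' g.1.1, by rw [Matrix.charpoly_toLin']; exact g.2⟩) ⟨?_, ?_⟩
    · intro g h hgh
      exact Subtype.ext (Units.ext (Matrix.toLin'.injective (Subtype.ext_iff.1 hgh)))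
    · rintro ⟨T, hT⟩
      have hT' : Irreducible (LinearMap.toMatrix' T).charpoly := by
        rwa [← Matrix.charpoly_toLin', Matrix.toLin'_toMatrix']
      have hu : IsUnit (LinearMap.toMatrix' T) := by
        rw [Matrix.isUnit_iff_isUnit_det, isUnit_iff_ne_zero, Matrix.det_eq_sign_charpoly_coeff]
        refine mul_ne_zero (by simp) fun h0 ↦ ?_
        have := natDegree_eq_of_degree_eq_some
          (degree_eq_one_of_irreducible_of_root hT' (x := 0) (by
            rw [IsRoot, ← coeff_zero_eq_eval_zero, h0]))
        rw [Matrix.charpoly_natDegree_eq_dim, Fintype.card_fin] at this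
        have h1 : e = 1 := this
        omega
      exact ⟨⟨hu.unit, hT'⟩, Subtype.ext (Matrix.toLin'_toMatrix' T)⟩
  have hfib : {T : Module.End F (Fin e → F) // Irreducible T.charpoly} ≃
      Σ f : monicIrreducibles F e, {T : Module.End F (Fin e → F) // T.charpoly = f} :=
    { toFun T := ⟨⟨T.1.charpoly, T.1.charpoly_monic, T.2, by
        rw [LinearMap.charpoly_natDegree, Module.finrank_fin_fun]⟩, T.1, rfl⟩
      invFun x := ⟨x.2.1, by rw [x.2.2]; exact x.1.2.2.1⟩
      left_inv T := rfl
      right_inv := by rintro ⟨⟨f, hf⟩, ⟨T, hT⟩⟩; cases hT; rfl }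
  rw [hGLEnd, Nat.card_congr hfib, Nat.card_sigma, Finset.sum_mul, ← hV]
  rw [Finset.sum_congr rfl fun f _ ↦ (card_charpoly_eq_mul_card_ne_zero f.2.1 f.2.2.1
    (by rw [f.2.2.2, Module.finrank_fin_fun])).trans hGL]
  rw [Finset.sum_const, smul_eq_mul, Finset.card_univ, ← Nat.card_eq_fintype_card,
    Nat.card_coe_set_eq]

end

/-- For `e ≥ 2` and a prime power `q`, the proportion `fat(e)` of elements of `GL(e,q)`
with irreducible characteristic polynomial satisfies `1/(e+1) ≤ fat(e) < 1/e`,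
stated here by cross-multiplication of the cardinalities. -/
theorem fat_proportion_bounds (q e : ℕ) (hq : IsPrimePow q) (he : 2 ≤ e)
    (F : Type) [Field F] [Fintype F] [DecidableEq F] (hF : Fintype.card F = q) :
    Nat.card (GL (Fin e) F) ≤
        (e + 1) * Nat.card {g : GL (Fin e) F //
          Irreducible ((g : Matrix (Fin e) (Fin e) F).charpoly)} ∧
      e * Nat.card {g : GL (Fin e) F //
          Irreducible ((g : Matrix (Fin e) (Fin e) F).charpoly)} <
        Nat.card (GL (Fin e) F) := by
  subst hF
  have hcount := card_irreducible_charpoly_mul (F := F) he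
  obtain ⟨hlow, hupp⟩ := bounds_of_sum_divisors (q := Nat.card F) Finite.one_lt_card
    (fun _ hn ↦ sum_divisors_mul_card_monicIrreducibles F hn) he
  have hGL : 0 < Nat.card (GL (Fin e) F) := Nat.card_pos
  have hpos : 0 < Nat.card F ^ e - 1 := Nat.zero_lt_of_lt hupp
  constructor
  · refine Nat.le_of_mul_le_mul_right (c := Nat.card F ^ e - 1) ?_ hpos
    rw [mul_assoc, hcount, ← mul_assoc, mul_comm]
    exact Nat.mul_le_mul_right _ hlow
  · refine Nat.lt_of_mul_lt_mul_right (a := Nat.card F ^ e - 1) ?_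
    rw [mul_assoc, hcount, ← mul_assoc, mul_comm (Nat.card (GL (Fin e) F))]
    exact Nat.mul_lt_mul_of_pos_right hupp hGL
end

section
/- Let d/2 < e < d, let G satisfy SL(d,q) ≤ G ≤ GL(d,q), and let W ≤ F_q^d be a subspace. Then the stabilizer G_W contains a fat(d,q;e)-element if and only if dim W ∈ [0, d−e] ∪ [e, d]; moreover in that case the proportion of fat(d,q;e)-elements in G_W equals fat(e), the proportion of elements of GL(e,q) with irreducible characteristic polynomial. -/
/-- A subspace is invariant under a matrix. -/
def MatInvariant {F : Type} [Field F] {d : ℕ} (g : Matrix (Fin d) (Fin d) F)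
    (U : Submodule F (Fin d → F)) : Prop :=
  U.map (Matrix.toLin' g) ≤ U

/-- A subspace is a nonzero irreducible `F_q⟨g⟩`-submodule. -/
def MatIrreducibleOn {F : Type} [Field F] {d : ℕ} (g : Matrix (Fin d) (Fin d) F)
    (U : Submodule F (Fin d → F)) : Prop :=
  U ≠ ⊥ ∧ MatInvariant g U ∧ ∀ W ≤ U, MatInvariant g W → W = ⊥ ∨ W = U

/-- `g` is a `fat(d,q;e)`-element. -/
def IsFatElt {F : Type} [Field F] [Fintype F] [DecidableEq F] {d : ℕ}
    (g : GL (Fin d) F) (e : ℕ) : Prop :=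
  ∃ U : Submodule F (Fin d → F),
    MatIrreducibleOn (g : Matrix (Fin d) (Fin d) F) U ∧ Module.finrank F U = e

open Polynomial Module

theorem LinearMap.injective_coprod_subtype_of_disjoint {F A V : Type*} [Field F]
    [AddCommGroup A] [Module F A] [AddCommGroup V] [Module F V] {a : A →ₗ[F] V}
    {W : Submodule F V} (ha : Function.Injective a) (h : Disjoint (LinearMap.range a) W) :
    Function.Injective (a.coprod W.subtype) := by
  rw [← LinearMap.ker_eq_bot, LinearMap.ker_coprod_of_disjoint_range, Submodule.ker_subtype,
    LinearMap.ker_eq_bot.2 ha, Submodule.prod_bot]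
  simpa using h

theorem LinearMap.bijective_coprod_subtype_of_isCompl {F A V : Type*} [Field F]
    [AddCommGroup A] [Module F A] [AddCommGroup V] [Module F V] {a : A →ₗ[F] V}
    {W : Submodule F V} (ha : Function.Injective a) (h : IsCompl (LinearMap.range a) W) :
    Function.Bijective (a.coprod W.subtype) := by
  refine ⟨injective_coprod_subtype_of_disjoint ha h.disjoint, ?_⟩
  rw [← LinearMap.range_eq_top, LinearMap.range_coprod, Submodule.range_subtype]
  exact h.sup_eq_top

theorem exists_linearEquiv_comp_eq_of_injective {F A V V' : Type*} [Field F]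
    [AddCommGroup A] [Module F A] [AddCommGroup V] [Module F V] [FiniteDimensional F V]
    [AddCommGroup V'] [Module F V'] [FiniteDimensional F V']
    (hV : finrank F V = finrank F V') (a : A →ₗ[F] V) (b : A →ₗ[F] V')
    (ha : Function.Injective a) (hb : Function.Injective b) :
    ∃ g : V ≃ₗ[F] V', ∀ x, g (a x) = b x := by
  obtain ⟨C, hC⟩ := exists_isCompl (LinearMap.range a)
  obtain ⟨D, hD⟩ := exists_isCompl (LinearMap.range b)
  have hCD : finrank F C = finrank F D := by
    have h1 := Submodule.finrank_add_eq_of_isCompl hC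
    have h2 := Submodule.finrank_add_eq_of_isCompl hD
    rw [LinearMap.finrank_range_of_inj ha] at h1
    rw [LinearMap.finrank_range_of_inj hb] at h2
    omega
  let ψ := LinearEquiv.ofFinrankEq C D hCD
  let eC := LinearEquiv.ofBijective _ (LinearMap.bijective_coprod_subtype_of_isCompl ha hC)
  let eD := LinearEquiv.ofBijective _ (LinearMap.bijective_coprod_subtype_of_isCompl hb hD)
  refine ⟨eC.symm ≪≫ₗ ((LinearEquiv.refl F A).prodCongr ψ) ≪≫ₗ eD, fun x => ?_⟩
  have : eC.symm (a x) = (x, 0) := by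
    rw [LinearEquiv.symm_apply_eq]
    simp [eC]
  simp [this, eD]

theorem Submodule.map_eq_self_of_map_le {F V : Type*} [Field F] [AddCommGroup V] [Module F V]
    [FiniteDimensional F V] (g : V ≃ₗ[F] V) (W : Submodule F V)
    (h : W.map (g : V →ₗ[F] V) ≤ W) : W.map (g : V →ₗ[F] V) = W :=
  Submodule.eq_of_le_of_finrank_eq h (LinearEquiv.finrank_map_eq g W)

theorem exists_linearEquiv_comp_eq_map_eq {F A V : Type*} [Field F]
    [AddCommGroup A] [Module F A] [AddCommGroup V] [Module F V] [FiniteDimensional F V]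
    (W : Submodule F V) (a b : A →ₗ[F] V)
    (ha : Function.Injective a) (hb : Function.Injective b)
    (h : (Disjoint (LinearMap.range a) W ∧ Disjoint (LinearMap.range b) W) ∨
      (LinearMap.range a ≤ W ∧ LinearMap.range b ≤ W)) :
    ∃ g : V ≃ₗ[F] V, (∀ x, g (a x) = b x) ∧ W.map (g : V →ₗ[F] V) = W := by
  rcases h with ⟨h1, h2⟩ | ⟨h1, h2⟩
  · obtain ⟨g, hg⟩ := exists_linearEquiv_comp_eq_of_injective rfl _ _
      (LinearMap.injective_coprod_subtype_of_disjoint ha h1)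
      (LinearMap.injective_coprod_subtype_of_disjoint hb h2)
    refine ⟨g, fun x => by simpa using hg (x, 0), Submodule.map_eq_self_of_map_le g W ?_⟩
    rintro _ ⟨w, hw, rfl⟩
    have := hg (0, ⟨w, hw⟩)
    simp only [LinearMap.coprod_apply, map_zero, Submodule.subtype_apply, zero_add] at this
    simpa [this] using hw
  · have ha' : ∀ x, a x ∈ W := fun x => h1 ⟨x, rfl⟩
    have hb' : ∀ x, b x ∈ W := fun x => h2 ⟨x, rfl⟩
    obtain ⟨k, hk⟩ := exists_linearEquiv_comp_eq_of_injective rfl (a.codRestrict W ha')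
      (b.codRestrict W hb') (fun x y hxy => ha (congrArg Subtype.val hxy))
      (fun x y hxy => hb (congrArg Subtype.val hxy))
    obtain ⟨g, hg⟩ := exists_linearEquiv_comp_eq_of_injective rfl W.subtype
      (W.subtype ∘ₗ (k : W →ₗ[F] W)) W.subtype_injective (W.subtype_injective.comp k.injective)
    refine ⟨g, fun x => ?_, Submodule.map_eq_self_of_map_le g W ?_⟩
    · have h3 := hg (a.codRestrict W ha' x)
      simp only [LinearMap.comp_apply, LinearEquiv.coe_coe, hk] at h3
      exact h3
    · rintro _ ⟨w, hw, rfl⟩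
      have h3 := hg ⟨w, hw⟩
      simp only [LinearMap.comp_apply, Submodule.subtype_apply] at h3
      simp only [LinearEquiv.coe_coe, h3]
      exact Subtype.property _

theorem exists_linearMap_det_eq_fixing {F V : Type*} [Field F]
    [AddCommGroup V] [Module F V] [FiniteDimensional F V] (U W : Submodule F V) (hU : U ≠ ⊤)
    (c : F) : ∃ t : V →ₗ[F] V, t.det = c ∧ (∀ u ∈ U, t u = u) ∧ W.map t ≤ W := by
  obtain ⟨v, hv, hvW⟩ : ∃ v, v ∉ U ∧ (v ∈ W ∨ W ≤ U) := by
    by_cases hW : W ≤ U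
    · obtain ⟨v, hv⟩ := SetLike.exists_not_mem_of_ne_top U hU
      exact ⟨v, hv, .inr hW⟩
    · obtain ⟨v, h1, h2⟩ := SetLike.not_le_iff_exists.1 hW
      exact ⟨v, h2, .inl h1⟩
  obtain ⟨f, hf, hfU⟩ := Submodule.exists_le_ker_of_notMem hv
  refine ⟨LinearMap.transvection (((c - 1) * (f v)⁻¹) • f) v, ?_, fun u hu => ?_, ?_⟩
  · rw [LinearMap.transvection.det]
    simp [hf]
  · have : f u = 0 := hfU hu
    simp [LinearMap.transvection.apply, this]
  · rintro _ ⟨w, hw, rfl⟩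
    rw [LinearMap.transvection.apply]
    rcases hvW with h | h
    · exact W.add_mem hw (W.smul_mem _ h)
    · have : f w = 0 := hfU (h hw)
      simpa [this] using hw

theorem exists_linearMap_det_eq_one_comp_eq {F A V : Type*} [Field F]
    [AddCommGroup A] [Module F A] [AddCommGroup V] [Module F V] [FiniteDimensional F V]
    (W : Submodule F V) (a b : A →ₗ[F] V)
    (ha : Function.Injective a) (hb : Function.Injective b) (hb' : LinearMap.range b ≠ ⊤)
    (h : (Disjoint (LinearMap.range a) W ∧ Disjoint (LinearMap.range b) W) ∨
      (LinearMap.range a ≤ W ∧ LinearMap.range b ≤ W)) :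
    ∃ g : V →ₗ[F] V, g.det = 1 ∧ g ∘ₗ a = b ∧ W.map g ≤ W := by
  obtain ⟨g, hg, hgW⟩ := exists_linearEquiv_comp_eq_map_eq W a b ha hb h
  obtain ⟨t, ht, htb, htW⟩ := exists_linearMap_det_eq_fixing (LinearMap.range b) W hb'
    (LinearMap.det (g : V →ₗ[F] V))⁻¹
  refine ⟨t ∘ₗ g, ?_, ?_, ?_⟩
  · rw [LinearMap.det_comp, ht]
    exact inv_mul_cancel₀ (LinearEquiv.isUnit_det' g).ne_zero
  · ext x
    simp [hg, htb (b x) ⟨x, rfl⟩]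
  · rw [Submodule.map_comp, hgW]
    exact htW

/-- Evaluation of polynomials in an endomorphism at a fixed vector. -/
noncomputable def Module.End.polyEval {F V : Type*} [Field F] [AddCommGroup V] [Module F V]
    (f : Module.End F V) (v : V) : F[X] →ₗ[F] V :=
  (LinearMap.applyₗ v) ∘ₗ (aeval f).toLinearMap

@[simp]
theorem Module.End.polyEval_apply {F V : Type*} [Field F] [AddCommGroup V] [Module F V]
    (f : Module.End F V) (v : V) (p : F[X]) : f.polyEval v p = aeval f p v := rfl

theorem Module.End.aeval_apply_mem_of_map_le {F V : Type*} [Field F] [AddCommGroup V] [Module F V]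
    {f : Module.End F V} {U : Submodule F V} (hU : U.map f ≤ U) (p : F[X]) {u : V} (hu : u ∈ U) :
    aeval f p u ∈ U := by
  induction p using Polynomial.induction_on' with
  | add p q hp hq => simpa using U.add_mem hp hq
  | monomial n a =>
    rw [aeval_monomial]
    simp only [Module.End.mul_apply, Module.algebraMap_end_apply]
    refine U.smul_mem _ ?_
    induction n with
    | zero => simpa using hu
    | succ n ih =>
      rw [pow_succ', Module.End.mul_apply]
      exact hU ⟨_, ih, rfl⟩

theorem Polynomial.finrank_degreeLT {F : Type*} [Field F] (n : ℕ) :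
    finrank F (degreeLT F n) = n := by
  rw [(degreeLTEquiv F n).finrank_eq, finrank_fin_fun]

theorem Module.End.eq_bot_or_eq_top_of_irreducible_charpoly {F V : Type*} [Field F]
    [AddCommGroup V] [Module F V] [FiniteDimensional F V] {f : Module.End F V}
    (hf : Irreducible f.charpoly) {U : Submodule F V} (hU : U.map f ≤ U) : U = ⊥ ∨ U = ⊤ := by
  refine or_iff_not_imp_left.2 fun hne => ?_
  obtain ⟨v, hv, hv0⟩ := U.ne_bot_iff.1 hne
  have hinj : Function.Injective (f.polyEval v ∘ₗ (degreeLT F (finrank F V)).subtype) := by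
    rw [← LinearMap.ker_eq_bot, LinearMap.ker_eq_bot']
    rintro ⟨p, hp⟩ h0
    simp only [LinearMap.comp_apply, Submodule.subtype_apply, polyEval_apply] at h0
    by_contra hp0
    have hp0 : p ≠ 0 := fun h => hp0 (Subtype.ext h)
    have hcop : IsCoprime f.charpoly p := by
      refine hf.coprime_iff_not_dvd.2 fun hdvd => ?_
      have h1 := natDegree_le_of_dvd hdvd hp0
      rw [f.charpoly_natDegree] at h1
      rw [mem_degreeLT, ← natDegree_lt_iff_degree_lt hp0] at hp
      omega
    obtain ⟨r, s, hrs⟩ := hcop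
    apply hv0
    have := congrArg (fun q => aeval f q v) hrs
    simpa [LinearMap.aeval_self_charpoly, h0] using this.symm
  have hle : LinearMap.range (f.polyEval v ∘ₗ (degreeLT F (finrank F V)).subtype) ≤ U := by
    rintro _ ⟨p, rfl⟩
    exact aeval_apply_mem_of_map_le hU _ hv
  refine Submodule.eq_top_of_finrank_eq (le_antisymm (Submodule.finrank_le _) ?_)
  calc finrank F V = finrank F (degreeLT F (finrank F V)) := (finrank_degreeLT _).symm
    _ = _ := (LinearMap.finrank_range_of_inj hinj).symm
    _ ≤ _ := Submodule.finrank_mono hle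

theorem Module.End.ker_aeval_eq_bot_of_natDegree_lt {F V : Type*} [Field F]
    [AddCommGroup V] [Module F V] [FiniteDimensional F V] {f : Module.End F V}
    (hf : ∀ U : Submodule F V, U.map f ≤ U → U = ⊥ ∨ U = ⊤) {r : F[X]} (hr : r.Monic)
    (hdeg : r.natDegree < finrank F V) : LinearMap.ker (aeval f r) = ⊥ := by
  have hcomm : ∀ (p : F[X]) (x : V), f (aeval f p x) = aeval f p (f x) := fun p x => by
    have := congrArg (fun q => aeval f q x) (mul_comm X p)
    simpa using this
  refine (hf _ ?_).resolve_right fun htop => ?_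
  · rintro _ ⟨x, hx, rfl⟩
    have hx : aeval f r x = 0 := hx
    simp [← hcomm, hx]
  · have : Nontrivial V := nontrivial_of_finrank_pos (R := F) (by omega)
    obtain ⟨v, hv⟩ := exists_ne (0 : V)
    have hr0 : ∀ x, aeval f r x = 0 := fun x => by
      have : x ∈ LinearMap.ker (aeval f r) := htop ▸ Submodule.mem_top
      exact this
    have hrange : LinearMap.range (f.polyEval v) = ⊤ := by
      refine (hf _ ?_).resolve_left fun hbot => hv ?_
      · rintro _ ⟨_, ⟨p, rfl⟩, rfl⟩
        exact ⟨X * p, by simp⟩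
      · have : f.polyEval v 1 ∈ LinearMap.range (f.polyEval v) := ⟨1, rfl⟩
        simpa [hbot] using this
    have hle : LinearMap.range (f.polyEval v) ≤ (degreeLT F r.natDegree).map (f.polyEval v) := by
      rintro _ ⟨p, rfl⟩
      refine ⟨p %ₘ r, ?_, ?_⟩
      · rw [SetLike.mem_coe, mem_degreeLT, ← degree_eq_natDegree hr.ne_zero]
        exact degree_modByMonic_lt p hr
      · conv_rhs => rw [← modByMonic_add_div p r]
        simp [hr0]
    have h1 := Submodule.finrank_mono hle
    have h2 := Submodule.finrank_map_le (f.polyEval v) (degreeLT F r.natDegree)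
    rw [hrange, finrank_top] at h1
    rw [finrank_degreeLT] at h2
    omega

theorem Module.End.irreducible_charpoly_iff {F V : Type*} [Field F] [AddCommGroup V] [Module F V]
    [FiniteDimensional F V] [Nontrivial V] (f : Module.End F V) :
    Irreducible f.charpoly ↔ ∀ U : Submodule F V, U.map f ≤ U → U = ⊥ ∨ U = ⊤ := by
  refine ⟨fun hf U hU => eq_bot_or_eq_top_of_irreducible_charpoly hf hU, fun hf => ?_⟩
  refine f.charpoly_monic.irreducible_iff_natDegree.2 ⟨fun h1 => ?_, fun p q hp hq hpq => ?_⟩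
  · have := f.charpoly_natDegree
    rw [h1, natDegree_one] at this
    exact finrank_pos.ne this
  · by_contra! hdeg
    have hsum := f.charpoly_natDegree
    rw [← hpq, hp.natDegree_mul hq] at hsum
    have hkp := LinearMap.ker_eq_bot.1 (ker_aeval_eq_bot_of_natDegree_lt hf hp (by omega))
    have hkq := LinearMap.ker_eq_bot.1 (ker_aeval_eq_bot_of_natDegree_lt hf hq (by omega))
    obtain ⟨v, hv⟩ := exists_ne (0 : V)
    have h0 := congrArg (fun g => g v) (LinearMap.aeval_self_charpoly f)
    rw [← hpq] at h0
    simp only [map_mul, Module.End.mul_apply, LinearMap.zero_apply] at h0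
    exact hv (hkq (by simpa using hkp (h0.trans (map_zero _).symm)))

theorem exists_GL_irreducible_charpoly_of_powerBasis {F L : Type*} [Field F] [Field L]
    [Algebra F L] (pb : PowerBasis F L) (hpb : 1 < pb.dim) :
    ∃ h : GL (Fin pb.dim) F, Irreducible (h : Matrix (Fin pb.dim) (Fin pb.dim) F).charpoly := by
  have hfin : FiniteDimensional F L := pb.finite
  have hgen : pb.gen ≠ 0 := by
    intro h0
    have := pb.natDegree_minpoly
    rw [h0, minpoly.zero, natDegree_X] at this
    omega
  obtain ⟨h, hh⟩ := (isUnit_iff_ne_zero.2 hgen).map (Algebra.leftMulMatrix pb.basis)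
  refine ⟨h, ?_⟩
  rw [hh, charpoly_leftMulMatrix]
  exact minpoly.irreducible pb.isIntegral_gen

theorem exists_GL_irreducible_charpoly (F : Type*) [Field F] [Finite F] {e : ℕ} (he : 1 < e) :
    ∃ h : GL (Fin e) F, Irreducible (h : Matrix (Fin e) (Fin e) F).charpoly := by
  obtain ⟨p, hp⟩ := CharP.exists F
  have : Fact p.Prime := ⟨CharP.char_is_prime F p⟩
  have : NeZero e := ⟨by omega⟩
  let pb := Field.powerBasisOfFiniteOfSeparable F (FiniteField.Extension F p e)
  have hdim : pb.dim = e := by rw [← pb.finrank, FiniteField.finrank_extension]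
  have key := exists_GL_irreducible_charpoly_of_powerBasis pb (by omega)
  rwa [hdim] at key

theorem Nat.card_eq_mul_of_card_fiber {A B : Type*} [Finite A] [Finite B] (f : A → B) {n : ℕ}
    (h : ∀ b, Nat.card {a // f a = b} = n) : Nat.card A = Nat.card B * n := by
  have := Fintype.ofFinite B
  rw [← Nat.card_congr (Equiv.sigmaFiberEquiv f), Nat.card_sigma]
  simp [h]

theorem MulAction.card_smul_eq_of_isPretransitive {S Z : Type*} [Group S] [Finite S] [MulAction S Z]
    [Finite Z] [MulAction.IsPretransitive S Z] (z w : Z) :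
    Nat.card Z * Nat.card {s : S // s • z = w} = Nat.card S := by
  obtain ⟨k, rfl⟩ := MulAction.exists_smul_eq S z w
  have : Nat.card {s : S // s • z = k • z} = Nat.card (MulAction.stabilizer S z) := by
    refine Nat.card_congr ((Equiv.mulLeft k⁻¹).subtypeEquiv fun s => ?_)
    simp [MulAction.mem_stabilizer_iff, mul_smul, inv_smul_eq_iff]
  rw [this, ← MulAction.index_stabilizer_of_transitive S z, mul_comm]
  exact Subgroup.card_mul_index _

theorem MulAction.card_smul_eq_apply_of_isPretransitive {S Z : Type*} [Group S] [Finite S]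
    [MulAction S Z] [Finite Z] [Nonempty Z] [MulAction.IsPretransitive S Z] (t : Z → Z) :
    Nat.card {p : S × Z // p.1 • p.2 = t p.2} = Nat.card S := by
  obtain ⟨z₀⟩ := ‹Nonempty Z›
  rw [Nat.card_eq_mul_of_card_fiber (fun p : {p : S × Z // p.1 • p.2 = t p.2} => p.1.2)
    (n := Nat.card {s : S // s • z₀ = z₀}) fun z => ?_,
    MulAction.card_smul_eq_of_isPretransitive z₀ z₀]
  have h : Nat.card {s : S // s • z = t z} = Nat.card {s : S // s • z₀ = z₀} :=
    Nat.eq_of_mul_eq_mul_left (Nat.card_pos (α := Z))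
      ((card_smul_eq_of_isPretransitive z (t z)).trans
        (card_smul_eq_of_isPretransitive z₀ z₀).symm)
  rw [← h]
  refine Nat.card_congr
    { toFun := fun p => ⟨p.1.1.1, by have := p.1.2; rwa [p.2] at this⟩
      invFun := fun s => ⟨⟨(s.1, z), s.2⟩, rfl⟩
      left_inv := ?_
      right_inv := fun s => rfl }
  rintro ⟨⟨⟨s, z'⟩, h1⟩, rfl⟩
  rfl

theorem Matrix.exists_GL_eq_mul_of_range_le {F : Type*} [Field F] {d e : ℕ}
    {a z : Matrix (Fin d) (Fin e) F} (ha : Function.Injective (Matrix.toLin' a))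
    (hz : Function.Injective (Matrix.toLin' z))
    (h : LinearMap.range (Matrix.toLin' a) ≤ LinearMap.range (Matrix.toLin' z)) :
    ∃ k : GL (Fin e) F, a = z * (k : Matrix (Fin e) (Fin e) F) := by
  let k : (Fin e → F) →ₗ[F] (Fin e → F) :=
    (LinearEquiv.ofInjective _ hz).symm ∘ₗ (Matrix.toLin' a).codRestrict _ fun x => h ⟨x, rfl⟩
  have hk : Matrix.toLin' z ∘ₗ k = Matrix.toLin' a := by
    ext1 x
    refine LinearMap.ext fun y => ?_
    have := LinearEquiv.apply_symm_apply (LinearEquiv.ofInjective _ hz)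
      ((Matrix.toLin' a).codRestrict _ (fun x => h ⟨x, rfl⟩) (LinearMap.single F (fun _ => F) x y))
    exact congrArg Subtype.val this
  have hkinj : Function.Injective k := by
    rw [← hk, LinearMap.coe_comp] at ha
    exact ha.of_comp
  have hunit : IsUnit (LinearMap.toMatrix' k) := by
    rw [← Matrix.mulVec_injective_iff_isUnit]
    intro x y hxy
    apply hkinj
    simpa [LinearMap.toMatrix'_mulVec] using hxy
  obtain ⟨u, hu⟩ := hunit
  refine ⟨u, Matrix.toLin'.injective ?_⟩
  rw [hu, Matrix.toLin'_mul, Matrix.toLin'_toMatrix', hk]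

theorem matIrreducibleOn_range_iff {F : Type} [Field F] {d e : ℕ} (he : 0 < e)
    {g : Matrix (Fin d) (Fin d) F} {z : Matrix (Fin d) (Fin e) F} {h : Matrix (Fin e) (Fin e) F}
    (hz : Function.Injective (Matrix.toLin' z)) (hgz : g * z = z * h) :
    MatIrreducibleOn g (LinearMap.range (Matrix.toLin' z)) ↔ Irreducible h.charpoly := by
  have : NeZero e := ⟨he.ne'⟩
  have hcomp : Matrix.toLin' g ∘ₗ Matrix.toLin' z = Matrix.toLin' z ∘ₗ Matrix.toLin' h := by
    rw [← Matrix.toLin'_mul, ← Matrix.toLin'_mul, hgz]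
  have hmap : ∀ U : Submodule F (Fin e → F), (U.map (Matrix.toLin' z)).map (Matrix.toLin' g) =
      (U.map (Matrix.toLin' h)).map (Matrix.toLin' z) := fun U => by
    rw [← Submodule.map_comp, hcomp, Submodule.map_comp]
  have hminj := Submodule.map_injective_of_injective hz
  rw [← Matrix.charpoly_toLin', Module.End.irreducible_charpoly_iff, ← Submodule.map_top]
  constructor
  · rintro ⟨-, -, h3⟩ U hU
    refine (h3 (U.map (Matrix.toLin' z)) (Submodule.map_mono le_top) ?_).imp
      (fun h => hminj (by simpa using h)) (fun h => hminj h)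
    rw [MatInvariant, hmap]
    exact Submodule.map_mono hU
  · intro h3
    refine ⟨fun h => ?_, ?_, fun U hU hinv => ?_⟩
    · exact top_ne_bot (hminj (h.trans (Submodule.map_bot _).symm))
    · rw [MatInvariant, hmap]
      exact Submodule.map_mono le_top
    · obtain ⟨U, rfl⟩ : ∃ U', U'.map (Matrix.toLin' z) = U :=
        ⟨U.comap _, by rwa [Submodule.map_comap_eq, inf_eq_right, ← Submodule.map_top]⟩
      rw [MatInvariant, hmap, Submodule.map_le_map_iff_of_injective hz] at hinv
      exact (h3 U hinv).imp (fun h => by rw [h, Submodule.map_bot]) (fun h => by rw [h])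

theorem MatInvariant.inf {F : Type} [Field F] {d : ℕ} {g : Matrix (Fin d) (Fin d) F}
    {U W : Submodule F (Fin d → F)} (hU : MatInvariant g U) (hW : MatInvariant g W) :
    MatInvariant g (U ⊓ W) :=
  (Submodule.map_inf_le _).trans (inf_le_inf hU hW)

theorem MatIrreducibleOn.disjoint_or_le {F : Type} [Field F] {d : ℕ}
    {g : Matrix (Fin d) (Fin d) F} {U W : Submodule F (Fin d → F)} (hU : MatIrreducibleOn g U)
    (hW : MatInvariant g W) : Disjoint U W ∨ U ≤ W :=
  (hU.2.2 (U ⊓ W) inf_le_left (hU.2.1.inf hW)).imp disjoint_iff.2 inf_eq_left.1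

theorem MatIrreducibleOn.eq_of_lt_two_mul_finrank {F : Type} [Field F] {d : ℕ}
    {g : Matrix (Fin d) (Fin d) F} {U W : Submodule F (Fin d → F)} (hU : MatIrreducibleOn g U)
    (hW : MatIrreducibleOn g W) (h : finrank F U = finrank F W) (hd : d < 2 * finrank F U) :
    U = W := by
  rcases hU.disjoint_or_le hW.2.1 with h1 | h1
  · have := Submodule.finrank_add_finrank_le_of_disjoint h1
    rw [finrank_fin_fun] at this
    omega
  · exact Submodule.eq_of_le_of_finrank_eq h1 h

theorem Matrix.GeneralLinearGroup.injective_toLin' {F : Type*} [Field F] {d : ℕ}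
    (g : GL (Fin d) F) : Function.Injective (Matrix.toLin' (g : Matrix (Fin d) (Fin d) F)) :=
  Matrix.mulVec_injective_of_isUnit g.isUnit

/-- The elements of `G` that stabilize the subspace `W`. -/
def stabilizerIn {F : Type} [Field F] {d : ℕ} (G : Subgroup (GL (Fin d) F))
    (W : Submodule F (Fin d → F)) : Subgroup (GL (Fin d) F) where
  carrier := {g | g ∈ G ∧ W.map (Matrix.toLin' (g : Matrix (Fin d) (Fin d) F)) = W}
  one_mem' := ⟨G.one_mem, by simp⟩
  mul_mem' := by
    rintro g h ⟨hg, hgW⟩ ⟨hh, hhW⟩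
    exact ⟨G.mul_mem hg hh, by
      rw [Units.val_mul, Matrix.toLin'_mul, Submodule.map_comp, hhW, hgW]⟩
  inv_mem' := by
    rintro g ⟨hg, hgW⟩
    refine ⟨G.inv_mem hg, ?_⟩
    conv_lhs => rw [← hgW]
    rw [← Submodule.map_comp, ← Matrix.toLin'_mul, Units.inv_mul]
    simp

/-- Injective linear maps `F^e → F^d`, given by their matrices, whose image either meets `W`
trivially or lies in `W`. -/
abbrev AdaptedFrame {F : Type} [Field F] {d : ℕ} (W : Submodule F (Fin d → F)) (e : ℕ) : Type :=
  {z : Matrix (Fin d) (Fin e) F // Function.Injective (Matrix.toLin' z) ∧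
    (Disjoint (LinearMap.range (Matrix.toLin' z)) W ∨ LinearMap.range (Matrix.toLin' z) ≤ W)}

namespace AdaptedFrame

variable {F : Type} [Field F] {d e : ℕ} {W : Submodule F (Fin d → F)}

theorem finrank_range (z : AdaptedFrame W e) :
    finrank F (LinearMap.range (Matrix.toLin' z.1)) = e := by
  rw [LinearMap.finrank_range_of_inj z.2.1, finrank_fin_fun]

instance (G : Subgroup (GL (Fin d) F)) : MulAction (stabilizerIn G W) (AdaptedFrame W e) where
  smul g z := ⟨((g : GL (Fin d) F) : Matrix (Fin d) (Fin d) F) * z.1, by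
    have hg := Matrix.GeneralLinearGroup.injective_toLin' (g : GL (Fin d) F)
    rw [Matrix.toLin'_mul, LinearMap.range_comp]
    refine ⟨hg.comp z.2.1, z.2.2.imp (fun h => ?_) fun h => ?_⟩
    · exact (Submodule.disjoint_map hg h).mono_right g.2.2.ge
    · exact (Submodule.map_mono h).trans g.2.2.le⟩
  one_smul z := Subtype.ext (Matrix.one_mul z.1)
  mul_smul g h z := Subtype.ext
    (Matrix.mul_assoc ((g : GL (Fin d) F) : Matrix (Fin d) (Fin d) F) (h : GL (Fin d) F) z.1)

@[simp]
theorem coe_smul {G : Subgroup (GL (Fin d) F)} (g : stabilizerIn G W) (z : AdaptedFrame W e) :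
    (g • z).1 = ((g : GL (Fin d) F) : Matrix (Fin d) (Fin d) F) * z.1 := rfl

theorem range_mul_GL (z : Matrix (Fin d) (Fin e) F) (h : GL (Fin e) F) :
    LinearMap.range (Matrix.toLin' (z * (h : Matrix (Fin e) (Fin e) F))) =
      LinearMap.range (Matrix.toLin' z) := by
  have hh : Function.Surjective (Matrix.toLin' (h : Matrix (Fin e) (Fin e) F)) :=
    LinearMap.injective_iff_surjective.1 (Matrix.GeneralLinearGroup.injective_toLin' h)
  rw [Matrix.toLin'_mul, LinearMap.range_comp_of_range_eq_top _ (LinearMap.range_eq_top.2 hh)]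

/-- Precomposition of a frame with an automorphism of `F^e`. -/
def mulRight (h : GL (Fin e) F) (z : AdaptedFrame W e) : AdaptedFrame W e :=
  ⟨z.1 * (h : Matrix (Fin e) (Fin e) F), by
    rw [range_mul_GL, Matrix.toLin'_mul]
    exact ⟨z.2.1.comp (Matrix.GeneralLinearGroup.injective_toLin' h), z.2.2⟩⟩

@[simp]
theorem coe_mulRight (h : GL (Fin e) F) (z : AdaptedFrame W e) :
    (z.mulRight h).1 = z.1 * (h : Matrix (Fin e) (Fin e) F) := rfl

theorem mulRight_mul (h k : GL (Fin e) F) (z : AdaptedFrame W e) :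
    z.mulRight (h * k) = (z.mulRight h).mulRight k :=
  Subtype.ext (by simp [Matrix.mul_assoc])

theorem smul_mulRight {G : Subgroup (GL (Fin d) F)} (g : stabilizerIn G W) (h : GL (Fin e) F)
    (z : AdaptedFrame W e) : g • z.mulRight h = (g • z).mulRight h :=
  Subtype.ext (by simp [Matrix.mul_assoc])

theorem mulRight_injective (z : AdaptedFrame W e) :
    Function.Injective fun h : GL (Fin e) F => z.mulRight h := by
  intro h k hhk
  have h1 := congrArg (fun w => Matrix.toLin' w.1) hhk
  simp only [coe_mulRight, Matrix.toLin'_mul] at h1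
  refine Units.ext (Matrix.toLin'.injective (LinearMap.ext fun x => z.2.1 ?_))
  exact congrArg (fun l => l x) h1

theorem exists_eq_mulRight {z w : AdaptedFrame W e}
    (h : LinearMap.range (Matrix.toLin' w.1) ≤ LinearMap.range (Matrix.toLin' z.1)) :
    ∃ k : GL (Fin e) F, w = z.mulRight k :=
  (Matrix.exists_GL_eq_mul_of_range_le w.2.1 z.2.1 h).imp fun _ hk => Subtype.ext hk

theorem irreducible_charpoly_iff {G : Subgroup (GL (Fin d) F)} {g : stabilizerIn G W}
    {z : AdaptedFrame W e} {h : GL (Fin e) F} (he : 0 < e) (hgz : g • z = z.mulRight h) :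
    Irreducible (h : Matrix (Fin e) (Fin e) F).charpoly ↔
      MatIrreducibleOn ((g : GL (Fin d) F) : Matrix (Fin d) (Fin d) F)
        (LinearMap.range (Matrix.toLin' z.1)) :=
  (matIrreducibleOn_range_iff he z.2.1 (congrArg Subtype.val hgz)).symm

theorem isPretransitive {G : Subgroup (GL (Fin d) F)}
    (hG : ∀ g : GL (Fin d) F, (g : Matrix (Fin d) (Fin d) F).det = 1 → g ∈ G)
    (he : d < 2 * e) (he' : e < d) :
    MulAction.IsPretransitive (stabilizerIn G W) (AdaptedFrame W e) := by
  have hdisj : ∀ z w : AdaptedFrame W e, Disjoint (LinearMap.range (Matrix.toLin' z.1)) W →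
      ¬ LinearMap.range (Matrix.toLin' w.1) ≤ W := fun z w hz hw => by
    have h1 := Submodule.finrank_add_finrank_le_of_disjoint hz
    have h2 := Submodule.finrank_mono hw
    rw [finrank_range, finrank_fin_fun] at h1
    rw [finrank_range] at h2
    omega
  refine ⟨fun z w => ?_⟩
  have hzw : (Disjoint (LinearMap.range (Matrix.toLin' z.1)) W ∧
      Disjoint (LinearMap.range (Matrix.toLin' w.1)) W) ∨
      (LinearMap.range (Matrix.toLin' z.1) ≤ W ∧ LinearMap.range (Matrix.toLin' w.1) ≤ W) := by
    rcases z.2.2 with h1 | h1 <;> rcases w.2.2 with h2 | h2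
    · exact .inl ⟨h1, h2⟩
    · exact (hdisj z w h1 h2).elim
    · exact (hdisj w z h2 h1).elim
    · exact .inr ⟨h1, h2⟩
  have htop : LinearMap.range (Matrix.toLin' w.1) ≠ ⊤ := fun h => by
    have := w.finrank_range
    rw [h, finrank_top, finrank_fin_fun] at this
    omega
  obtain ⟨g, hdet, hgz, hgW⟩ := exists_linearMap_det_eq_one_comp_eq W _ _ z.2.1 w.2.1 htop hzw
  have hdet' : (LinearMap.toMatrix' g).det = 1 := by rw [LinearMap.det_toMatrix', hdet]
  let γ : GL (Fin d) F := Matrix.GeneralLinearGroup.mkOfDetNeZero (LinearMap.toMatrix' g)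
    (hdet' ▸ one_ne_zero)
  have hγ : (γ : Matrix (Fin d) (Fin d) F) = LinearMap.toMatrix' g := rfl
  have hγW : W.map (Matrix.toLin' (γ : Matrix (Fin d) (Fin d) F)) = W := by
    refine Submodule.eq_of_le_of_finrank_eq ?_ ?_
    · rwa [hγ, Matrix.toLin'_toMatrix']
    · exact (Submodule.equivMapOfInjective _ γ.injective_toLin' W).finrank_eq.symm
  refine ⟨⟨γ, hG γ hdet', hγW⟩, Subtype.ext (Matrix.toLin'.injective ?_)⟩
  rw [coe_smul, Matrix.toLin'_mul, hγ, Matrix.toLin'_toMatrix', hgz]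

theorem nonempty_of_finrank (he' : e < d) (h : finrank F W ≤ d - e ∨ e ≤ finrank F W) :
    Nonempty (AdaptedFrame W e) := by
  have key : ∀ C : Submodule F (Fin d → F), e ≤ finrank F C → (Disjoint C W ∨ C ≤ W) →
      Nonempty (AdaptedFrame W e) := fun C hC hCW => by
    obtain ⟨l, hl⟩ := (finrank_le_iff_exists_linearMap (R := F) (M := Fin e → F) (M' := C)).1
      (by rwa [finrank_fin_fun])
    have hle : LinearMap.range (C.subtype ∘ₗ l) ≤ C := by
      rintro _ ⟨x, rfl⟩
      exact (l x).2
    refine ⟨LinearMap.toMatrix' (C.subtype ∘ₗ l), ?_, ?_⟩ <;> rw [Matrix.toLin'_toMatrix']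
    · exact C.subtype_injective.comp hl
    · exact hCW.imp (fun h => h.mono_left hle) hle.trans
  rcases h with h | h
  · obtain ⟨C, hC⟩ := exists_isCompl W
    have := Submodule.finrank_add_eq_of_isCompl hC
    rw [finrank_fin_fun] at this
    exact key C (by omega) (.inl hC.disjoint.symm)
  · exact key W h (.inr le_rfl)

theorem exists_of_matIrreducibleOn {G : Subgroup (GL (Fin d) F)} (g : stabilizerIn G W)
    {U : Submodule F (Fin d → F)} (hU : finrank F U = e)
    (hgU : MatIrreducibleOn ((g : GL (Fin d) F) : Matrix (Fin d) (Fin d) F) U) :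
    ∃ z : AdaptedFrame W e, LinearMap.range (Matrix.toLin' z.1) = U := by
  let l : (Fin e → F) ≃ₗ[F] U := LinearEquiv.ofFinrankEq _ _ (by rw [finrank_fin_fun, hU])
  have hr : LinearMap.range (U.subtype ∘ₗ (l : (Fin e → F) →ₗ[F] U)) = U := by
    rw [LinearMap.range_comp, LinearEquiv.range, Submodule.map_top, Submodule.range_subtype]
  refine ⟨⟨LinearMap.toMatrix' (U.subtype ∘ₗ (l : (Fin e → F) →ₗ[F] U)), ?_, ?_⟩, ?_⟩ <;>
    rw [Matrix.toLin'_toMatrix']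
  · exact U.subtype_injective.comp l.injective
  · rw [hr]
    exact hgU.disjoint_or_le g.2.2.le
  · exact hr

theorem card_semiconj_irreducible [Fintype F] [DecidableEq F] {G : Subgroup (GL (Fin d) F)}
    (he : d < 2 * e) {g : stabilizerIn G W} (hg : IsFatElt (g : GL (Fin d) F) e) :
    Nat.card {p : GL (Fin e) F × AdaptedFrame W e //
      Irreducible (p.1 : Matrix (Fin e) (Fin e) F).charpoly ∧ g • p.2 = p.2.mulRight p.1} =
    Nat.card (GL (Fin e) F) := by
  obtain ⟨U, hgU, hU⟩ := hg
  obtain ⟨z, rfl⟩ := exists_of_matIrreducibleOn g hU hgU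
  have hgz : LinearMap.range (Matrix.toLin' (g • z).1) ≤ LinearMap.range (Matrix.toLin' z.1) := by
    rw [coe_smul, Matrix.toLin'_mul, LinearMap.range_comp]
    exact hgU.2.1
  obtain ⟨h, hh⟩ := exists_eq_mulRight hgz
  have hk : ∀ k : GL (Fin e) F, g • z.mulRight k = (z.mulRight k).mulRight (k⁻¹ * h * k) := by
    intro k
    rw [smul_mulRight, hh, ← mulRight_mul, ← mulRight_mul]
    congr 1
    group
  refine (Nat.card_eq_of_bijective (fun k : GL (Fin e) F =>
    (⟨(k⁻¹ * h * k, z.mulRight k), ?_, hk k⟩ : {p : GL (Fin e) F × AdaptedFrame W e //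
      Irreducible (p.1 : Matrix (Fin e) (Fin e) F).charpoly ∧ g • p.2 = p.2.mulRight p.1}))
    ⟨fun k k' hkk' => ?_, ?_⟩).symm
  · rw [irreducible_charpoly_iff (by omega) (hk k), coe_mulRight, range_mul_GL]
    exact hgU
  · exact z.mulRight_injective (congrArg (fun p => p.1.2) hkk')
  · rintro ⟨⟨m, w⟩, hm, hw⟩
    dsimp only at hm hw
    rw [irreducible_charpoly_iff (by omega) hw] at hm
    have hrange := hm.eq_of_lt_two_mul_finrank hgU (by rw [finrank_range, finrank_range])
      (by rwa [finrank_range])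
    obtain ⟨k, rfl⟩ := exists_eq_mulRight hrange.le
    refine ⟨k, Subtype.ext (Prod.ext ?_ rfl)⟩
    exact (z.mulRight k).mulRight_injective ((hk k).symm.trans hw)

theorem card_fat_mul_card_GL [Fintype F] [DecidableEq F] {G : Subgroup (GL (Fin d) F)}
    (hG : ∀ g : GL (Fin d) F, (g : Matrix (Fin d) (Fin d) F).det = 1 → g ∈ G)
    (he : d < 2 * e) (he' : e < d) (h : finrank F W ≤ d - e ∨ e ≤ finrank F W) :
    Nat.card {g : stabilizerIn G W // IsFatElt (g : GL (Fin d) F) e} * Nat.card (GL (Fin e) F) =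
      Nat.card {h : GL (Fin e) F // Irreducible (h : Matrix (Fin e) (Fin e) F).charpoly} *
        Nat.card (stabilizerIn G W) := by
  have := nonempty_of_finrank he' h
  have := isPretransitive (W := W) hG he he'
  let Q := {p : GL (Fin e) F × stabilizerIn G W × AdaptedFrame W e //
    Irreducible (p.1 : Matrix (Fin e) (Fin e) F).charpoly ∧ p.2.1 • p.2.2 = p.2.2.mulRight p.1}
  have h1 := Nat.card_eq_mul_of_card_fiber
    (fun p : Q => (⟨p.1.1, p.2.1⟩ :
      {h : GL (Fin e) F // Irreducible (h : Matrix (Fin e) (Fin e) F).charpoly}))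
    (n := Nat.card (stabilizerIn G W)) fun h => by
      rw [← MulAction.card_smul_eq_apply_of_isPretransitive (S := stabilizerIn G W)
        (mulRight h.1 : AdaptedFrame W e → AdaptedFrame W e)]
      exact Nat.card_congr
        { toFun := fun p => ⟨p.1.1.2,
            p.1.2.2.trans (congrArg (fun x => p.1.1.2.2.mulRight x.1) p.2)⟩
          invFun := fun p => ⟨⟨(h.1, p.1), h.2, p.2⟩, rfl⟩
          left_inv := by rintro ⟨⟨⟨h, p⟩, h2⟩, rfl⟩; rfl
          right_inv := fun p => rfl }
  have h2 := Nat.card_eq_mul_of_card_fiber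
    (fun p : Q => (⟨p.1.2.1, _, (irreducible_charpoly_iff (by omega) p.2.2).1 p.2.1,
      p.1.2.2.finrank_range⟩ : {g : stabilizerIn G W // IsFatElt (g : GL (Fin d) F) e}))
    (n := Nat.card (GL (Fin e) F)) fun g => by
      rw [← card_semiconj_irreducible he g.2]
      exact Nat.card_congr
        { toFun := fun p => ⟨(p.1.1.1, p.1.1.2.2), p.1.2.1,
            (congrArg (fun x => x.1 • p.1.1.2.2) p.2).symm.trans p.1.2.2⟩
          invFun := fun p => ⟨⟨(p.1.1, g.1, p.1.2), p.2⟩, rfl⟩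
          left_inv := by rintro ⟨⟨⟨h, p⟩, h2⟩, rfl⟩; rfl
          right_inv := fun p => rfl }
  exact h2.symm.trans h1

end AdaptedFrame

/-- For `d/2 < e < d` and `SL(d,q) ≤ G ≤ GL(d,q)`, the stabilizer `G_W` contains a
`fat(d,q;e)`-element iff `dim W ∈ [0,d-e] ∪ [e,d]`, in which case the proportion of
`fat(d,q;e)`-elements in `G_W` equals `fat(e)` (stated by cross-multiplication). -/
theorem fat_proportion_in_stabilizer (q d e : ℕ) (hq : IsPrimePow q)
    (he : d < 2 * e) (he' : e < d)
    (F : Type) [Field F] [Fintype F] [DecidableEq F] (hF : Fintype.card F = q)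
    (G : Subgroup (GL (Fin d) F))
    (hG : ∀ g : GL (Fin d) F, (g : Matrix (Fin d) (Fin d) F).det = 1 → g ∈ G)
    (W : Submodule F (Fin d → F)) :
    ((∃ g : GL (Fin d) F, g ∈ G ∧
        W.map (Matrix.toLin' (g : Matrix (Fin d) (Fin d) F)) = W ∧ IsFatElt g e) ↔
      (Module.finrank F W ≤ d - e ∨ e ≤ Module.finrank F W)) ∧
    ((Module.finrank F W ≤ d - e ∨ e ≤ Module.finrank F W) →
      Nat.card {g : GL (Fin d) F // g ∈ G ∧
          W.map (Matrix.toLin' (g : Matrix (Fin d) (Fin d) F)) = W ∧ IsFatElt g e} *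
        Nat.card (GL (Fin e) F) =
      Nat.card {h : GL (Fin e) F //
          Irreducible ((h : Matrix (Fin e) (Fin e) F).charpoly)} *
        Nat.card {g : GL (Fin d) F // g ∈ G ∧
          W.map (Matrix.toLin' (g : Matrix (Fin d) (Fin d) F)) = W}) := by
  have hcard : Nat.card {g : GL (Fin d) F // g ∈ G ∧
        W.map (Matrix.toLin' (g : Matrix (Fin d) (Fin d) F)) = W ∧ IsFatElt g e} =
      Nat.card {g : stabilizerIn G W // IsFatElt (g : GL (Fin d) F) e} :=
    Nat.card_congr
      { toFun := fun g => ⟨⟨g.1, g.2.1, g.2.2.1⟩, g.2.2.2⟩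
        invFun := fun g => ⟨g.1.1, g.1.2.1, g.1.2.2, g.2⟩
        left_inv := fun g => rfl
        right_inv := fun g => rfl }
  have hprop := AdaptedFrame.card_fat_mul_card_GL (W := W) hG he he'
  rw [← hcard] at hprop
  refine ⟨⟨?_, fun h => ?_⟩, hprop⟩
  · rintro ⟨g, -, hgW, U, hU, rfl⟩
    rcases hU.disjoint_or_le hgW.le with h | h
    · have := Submodule.finrank_add_finrank_le_of_disjoint h
      rw [finrank_fin_fun] at this
      omega
    · exact .inr (Submodule.finrank_mono h)
  · obtain ⟨k, hk⟩ := exists_GL_irreducible_charpoly F (e := e) (by omega)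
    have : Nonempty {h : GL (Fin e) F // Irreducible (h : Matrix (Fin e) (Fin e) F).charpoly} :=
      ⟨⟨k, hk⟩⟩
    have hpos := Nat.mul_pos (Nat.card_pos
      (α := {h : GL (Fin e) F // Irreducible (h : Matrix (Fin e) (Fin e) F).charpoly}))
      (Nat.card_pos (α := stabilizerIn G W))
    rw [← hprop h] at hpos
    obtain ⟨⟨g, hg⟩⟩ := (Nat.card_pos_iff.1 (Nat.pos_of_mul_pos_right hpos)).1
    exact ⟨g, hg⟩
end

section
/- Let d ≥ 3 and SL(d,q) ≤ G ≤ GL(d,q). Then the proportion, among all pairs (g_1,g_2) ∈ G × G, of those pairs that are fat pairs generating a reducible subgroup (i.e., g_i has an irreducible F_q⟨g_i⟩-submodule of dimension e_i > d/2 for i = 1,2, and F_q^d is reducible as F_q⟨g_1,g_2⟩-module) is strictly less than q^{-(d-1)}. -/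
/-- `g` is a fat element: it has an irreducible invariant subspace of dimension `> d/2`. -/
def IsFat {F : Type} [Field F] [Fintype F] [DecidableEq F] {d : ℕ}
    (g : GL (Fin d) F) : Prop :=
  ∃ U : Submodule F (Fin d → F),
    MatIrreducibleOn (g : Matrix (Fin d) (Fin d) F) U ∧ d < 2 * Module.finrank F U

/-- `(g₁,g₂)` is a reducible pair: some nonzero proper subspace is invariant under both. -/
def IsRedPair {F : Type} [Field F] [Fintype F] [DecidableEq F] {d : ℕ}
    (g₁ g₂ : GL (Fin d) F) : Prop :=
  ∃ W : Submodule F (Fin d → F), W ≠ ⊥ ∧ W ≠ ⊤ ∧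
    MatInvariant (g₁ : Matrix (Fin d) (Fin d) F) W ∧
    MatInvariant (g₂ : Matrix (Fin d) (Fin d) F) W

open Module

/-- An endomorphism is irreducible when its only invariant subspaces are `⊥` and `⊤`. -/
def Module.End.IsIrred {F U : Type*} [Field F] [AddCommGroup U] [Module F U] (g : End F U) : Prop :=
  ∀ W : Submodule F U, W.map g ≤ W → W = ⊥ ∨ W = ⊤

theorem Module.End.IsIrred.exists_algHom {F U : Type*} [Field F] [Finite F] [AddCommGroup U]
    [Module F U] [Module.Finite F U] [Nontrivial U] (p : ℕ) [Fact p.Prime] [CharP F p]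
    [NeZero (finrank F U)] {g : End F U} (hg : g.IsIrred) :
    ∃ (φ : FiniteField.Extension F p (finrank F U) →ₐ[F] End F U)
      (x : FiniteField.Extension F p (finrank F U)), φ x = g := by
  let A := Algebra.adjoin F {g}
  have hcomm : ∀ a ∈ A, a * g = g * a := fun a ha ↦
    (Algebra.commute_of_mem_adjoin_self ha).eq.symm
  have : IsMulCommutative A := Algebra.isMulCommutative_adjoin F (by simp)
  have hinj : ∀ a : A, a ≠ 0 → ∀ u, (a : End F U) u = 0 → u = 0 := by
    intro a ha u hu
    rcases hg (LinearMap.ker (a : End F U)) (by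
      rintro _ ⟨w, hw, rfl⟩
      have hw' : (a : End F U) w = 0 := hw
      have := LinearMap.congr_fun (hcomm a a.2) w
      simp only [End.mul_apply, hw', map_zero] at this
      exact this) with h | h
    · have : u ∈ LinearMap.ker (a : End F U) := hu
      simpa [h] using this
    · exact absurd (Subtype.ext (LinearMap.ker_eq_top.mp h)) ha
  have : NoZeroDivisors A := ⟨by
    intro a b hab
    by_contra! h
    refine h.2 (Subtype.ext (LinearMap.ext fun u ↦ hinj a h.1 _ ?_))
    exact LinearMap.congr_fun (congr_arg Subtype.val hab) u⟩
  have : IsDomain A := NoZeroDivisors.to_isDomain A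
  have : Finite (End F U) := Module.finite_of_finite F
  have : Finite A := inferInstance
  let : Field A := (Finite.isField_of_domain A).toField
  obtain ⟨v, hv⟩ := exists_ne (0 : U)
  let ev : A →ₗ[F] U := (LinearMap.applyₗ v).comp A.val.toLinearMap
  have hbij : Function.Bijective ev := by
    constructor
    · refine (injective_iff_map_eq_zero ev).2 fun a ha ↦ ?_
      by_contra h
      exact hv (hinj a h v ha)
    · rw [← LinearMap.range_eq_top]
      refine (hg (LinearMap.range ev) ?_).resolve_left fun h ↦ hv ?_
      · rintro _ ⟨_, ⟨a, rfl⟩, rfl⟩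
        exact ⟨⟨g, Algebra.self_mem_adjoin_singleton F g⟩ * a, rfl⟩
      · have : ev 1 ∈ LinearMap.range ev := ⟨1, rfl⟩
        rw [h] at this
        exact this
  have hrank : finrank F A = finrank F U := (LinearEquiv.ofBijective ev hbij).finrank_eq
  let e := FiniteField.algEquivExtension F p (finrank F U) A hrank
  exact ⟨A.val.comp e.symm.toAlgHom, e ⟨g, Algebra.self_mem_adjoin_singleton F g⟩, by simp⟩

theorem Module.End.exists_conj_algHom {F U L : Type*} [Field F] [AddCommGroup U]
    [Module F U] [Module.Finite F U] [Nontrivial U] [Field L] [Algebra F L]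
    [FiniteDimensional F L] (h : finrank F L = finrank F U) (φ ψ : L →ₐ[F] End F U) :
    ∃ g : (End F U)ˣ, ∀ x, (g : End F U) * φ x = ψ x * g := by
  obtain ⟨v, hv⟩ := exists_ne (0 : U)
  have key : ∀ φ : L →ₐ[F] End F U, ∃ e : L ≃ₗ[F] U, ∀ x, e x = φ x v := by
    intro φ
    let ev : L →ₗ[F] U := (LinearMap.applyₗ v).comp φ.toLinearMap
    have hev : Function.Injective ev := by
      refine (injective_iff_map_eq_zero ev).2 fun x hx ↦ ?_
      by_contra h0
      apply hv
      have : φ (x⁻¹ * x) v = 0 := by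
        rw [map_mul, End.mul_apply, show φ x v = 0 from hx, map_zero]
      simpa [inv_mul_cancel₀ h0] using this
    exact ⟨LinearEquiv.ofInjectiveOfFinrankEq ev hev h, fun _ ↦ rfl⟩
  obtain ⟨e₁, h₁⟩ := key φ
  obtain ⟨e₂, h₂⟩ := key ψ
  refine ⟨LinearMap.GeneralLinearGroup.ofLinearEquiv (e₁.symm.trans e₂), fun x ↦ ?_⟩
  ext u
  obtain ⟨y, rfl⟩ := e₁.surjective u
  change e₂ (e₁.symm (φ x (e₁ y))) = ψ x (e₂ (e₁.symm (e₁ y)))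
  rw [h₁, ← End.mul_apply, ← map_mul, ← h₁, e₁.symm_apply_apply, h₂, ← h₁, e₁.symm_apply_apply, h₂,
    map_mul, End.mul_apply]

theorem Module.End.finrank_mul_card_isIrred_le (F U : Type*) [Field F] [Finite F] [AddCommGroup U]
    [Module F U] [Module.Finite F U] :
    finrank F U * Nat.card {g : (End F U)ˣ // (g : End F U).IsIrred} ≤ Nat.card (End F U)ˣ := by
  rcases subsingleton_or_nontrivial U with hU | hU
  · simp [finrank_zero_of_subsingleton]
  obtain ⟨p, hp⟩ := CharP.exists F
  have : Fact p.Prime := ⟨CharP.char_is_prime F p⟩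
  have : NeZero (finrank F U) := ⟨finrank_pos.ne'⟩
  have : Finite (End F U) := Module.finite_of_finite F
  let L := FiniteField.Extension F p (finrank F U)
  choose φ x hx using fun g : {g : (End F U)ˣ // (g : End F U).IsIrred} ↦ g.2.exists_algHom p
  by_cases hne : Nonempty (L →ₐ[F] End F U)
  swap
  · have : IsEmpty {g : (End F U)ˣ // (g : End F U).IsIrred} := ⟨fun g ↦ hne ⟨φ g⟩⟩
    simp
  obtain ⟨φ₀⟩ := hne
  choose c hc using exists_conj_algHom (FiniteField.finrank_extension F p (finrank F U)) φ₀
  rw [← FiniteField.natCard_algEquiv_extension F p (finrank F U), ← Nat.card_prod]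
  have hx0 : ∀ g, x g ≠ 0 := fun g h ↦ by
    have := hx g
    rw [h, map_zero] at this
    exact g.1.ne_zero this.symm
  let y (t : Gal(L/F) × {g : (End F U)ˣ // (g : End F U).IsIrred}) : Lˣ :=
    Units.mk0 (t.1.symm (x t.2)) (by simpa using hx0 t.2)
  let ψ (t : Gal(L/F) × {g : (End F U)ˣ // (g : End F U).IsIrred}) : L →ₐ[F] End F U :=
    (φ t.2).comp t.1.toAlgHom
  have hψ : ∀ t, ψ t (y t) = t.2.1 := fun t ↦ by simp [ψ, y, hx]
  refine Nat.card_le_card_of_injective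
    (fun t ↦ c (ψ t) * Units.map (φ₀ : L →* End F U) (y t)) fun s t hst ↦ ?_
  have hφ : ∀ t z, ((c (ψ t) * Units.map (φ₀ : L →* End F U) (y t) : (End F U)ˣ) : End F U) * φ₀ z
      = ψ t z * (c (ψ t) * Units.map (φ₀ : L →* End F U) (y t) : (End F U)ˣ) := by
    intro t z
    simp only [Units.val_mul, Units.coe_map, MonoidHom.coe_coe]
    rw [mul_assoc, ← map_mul, mul_comm, map_mul, ← mul_assoc, hc, mul_assoc]
  have h₁ : ψ s = ψ t := by
    ext1 z
    have h := hφ s z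
    dsimp only at hst
    rw [hst, hφ t z] at h
    exact (Units.mul_left_inj _).1 h.symm
  have h₂ : y s = y t := by
    dsimp only at hst
    rw [h₁, mul_right_inj] at hst
    exact Units.map_injective (f := (φ₀ : L →* End F U)) φ₀.toRingHom.injective hst
  have h₃ : s.2 = t.2 := Subtype.ext (Units.ext (by rw [← hψ, ← hψ, h₁, h₂]))
  refine Prod.ext ?_ h₃
  ext z
  have := DFunLike.congr_fun h₁ z
  simp only [ψ, h₃] at this
  exact (φ t.2).toRingHom.injective this

open scoped Pointwise

theorem Subgroup.card_mul_card_inf_stabilizer_le {E α : Type*} [Group E] [Finite E] [MulAction E α]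
    (K : Subgroup E) {S : Set α} (hS : ∀ x ∈ S, ∀ y ∈ S, ∃ k ∈ K, k • x = y) {x : α} (hx : x ∈ S) :
    Nat.card S * Nat.card (K ⊓ MulAction.stabilizer E x : Subgroup E) ≤ Nat.card K := by
  choose k hkK hk using hS x hx
  rw [← Nat.card_prod]
  refine Nat.card_le_card_of_injective
    (fun t : S × (K ⊓ MulAction.stabilizer E x : Subgroup E) ↦
      (⟨k t.1 t.1.2 * t.2, K.mul_mem (hkK _ _) t.2.2.1⟩ : K)) fun s t h ↦ ?_
  have h : k s.1 s.1.2 * s.2 = k t.1 t.1.2 * t.2 := congr_arg Subtype.val h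
  have key : ∀ s : S × (K ⊓ MulAction.stabilizer E x : Subgroup E),
      (k s.1 s.1.2 * (s.2 : E)) • x = s.1 := fun s ↦ by
    rw [mul_smul, show (s.2 : E) • x = x from s.2.2.2, hk]
  have h₁ : s.1 = t.1 := Subtype.ext ((key s).symm.trans ((congr_arg (· • x) h).trans (key t)))
  rw [h₁, mul_right_inj] at h
  exact Prod.ext h₁ (Subtype.ext h)

theorem MonoidHom.mul_card_preimage_le {K H : Type*} [Group K] [Group H] [Finite K] (ρ : K →* H)
    (hρ : Function.Surjective ρ) (P : H → Prop) {n : ℕ}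
    (hn : n * Nat.card {x // P x} ≤ Nat.card H) :
    n * Nat.card {k // P (ρ k)} ≤ Nat.card K := by
  have : Finite H := Finite.of_surjective ρ hρ
  choose s hs using hρ
  have h₁ : Nat.card {k // P (ρ k)} ≤ Nat.card ({x // P x} × ρ.ker) := by
    refine Nat.card_le_card_of_injective
      (fun k ↦ (⟨ρ k, k.2⟩, ⟨(s (ρ k))⁻¹ * k, by simp [MonoidHom.mem_ker, hs]⟩)) fun a b h ↦ ?_
    simp only [Prod.mk.injEq, Subtype.mk.injEq] at h
    rw [h.1, mul_right_inj] at h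
    exact Subtype.ext h.2
  have h₂ : Nat.card (H × ρ.ker) ≤ Nat.card K := by
    refine Nat.card_le_card_of_injective (fun t ↦ s t.1 * t.2) fun a b h ↦ ?_
    have ha : ∀ a : H × ρ.ker, ρ (s a.1 * a.2) = a.1 := fun a ↦ by
      rw [map_mul, hs, (MonoidHom.mem_ker).1 a.2.2, mul_one]
    dsimp only at h
    have h' : a.1 = b.1 := (ha a).symm.trans ((congr_arg ρ h).trans (ha b))
    rw [h', mul_right_inj] at h
    exact Prod.ext h' (Subtype.ext h)
  rw [Nat.card_prod] at h₁ h₂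
  calc n * Nat.card {k // P (ρ k)} ≤ n * (Nat.card {x // P x} * Nat.card ρ.ker) := by gcongr
    _ = n * Nat.card {x // P x} * Nat.card ρ.ker := by ring
    _ ≤ Nat.card H * Nat.card ρ.ker := by gcongr
    _ ≤ _ := h₂

theorem LinearMap.exists_linearEquiv_comp_eq {F V M : Type*} [Field F] [AddCommGroup V] [Module F V]
    [AddCommGroup M] [Module F M] [FiniteDimensional F M] {i j : M →ₗ[F] V}
    (hi : Function.Injective i) (hj : Function.Injective j) :
    ∃ g : V ≃ₗ[F] V, ∀ m, g (i m) = j m := by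
  obtain ⟨g, hg⟩ := Submodule.exists_linearEquiv_restrict_eq
    ((LinearEquiv.ofInjective i hi).symm ≪≫ₗ LinearEquiv.ofInjective j hj)
  refine ⟨g, fun m ↦ ?_⟩
  have := hg (LinearEquiv.ofInjective i hi m)
  simpa using this.symm

section Extend

variable {F V : Type*} [Field F] [AddCommGroup V] [Module F V] [FiniteDimensional F V]

theorem Submodule.smul_eq_of_map_le {W : Submodule F V} {g : V ≃ₗ[F] V}
    (h : W.map (g : V →ₗ[F] V) ≤ W) : g • W = W :=
  Submodule.eq_of_le_of_finrank_eq h (LinearEquiv.finrank_map_eq g W)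

theorem LinearEquiv.smul_eq_of_forall_apply_eq {U U' : Submodule F V} {g : V ≃ₗ[F] V}
    (φ : U ≃ₗ[F] U') (h : ∀ u : U, g u = φ u) : g • U = U' := by
  refine Submodule.eq_of_le_of_finrank_eq ?_ ((LinearEquiv.finrank_map_eq g U).trans φ.finrank_eq)
  rintro _ ⟨u, hu, rfl⟩
  change g u ∈ U'
  rw [h ⟨u, hu⟩]
  exact Subtype.coe_prop _

theorem LinearEquiv.exists_det_eq_of_notMem (A : Submodule F V) {v : V} (hv : v ∉ A) {c : F}
    (hc : c ≠ 0) : ∃ h : V ≃ₗ[F] V, LinearMap.det (h : V →ₗ[F] V) = c ∧ (∀ a ∈ A, h a = a) ∧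
      ∀ W : Submodule F V, v ∈ W → ∀ x ∈ W, h x ∈ W := by
  obtain ⟨f, hf, hfv⟩ := LinearMap.exists_extend_of_notMem (0 : A →ₗ[F] F) hv (c - 1)
  have hdet : LinearMap.det (LinearMap.transvection f v) = c := by
    rw [LinearMap.transvection.det, hfv, add_sub_cancel]
  have hne : LinearMap.det (LinearMap.transvection f v) ≠ 0 := by rwa [hdet]
  have hcoe : (LinearMap.equivOfDetNeZero _ hne : V →ₗ[F] V) = LinearMap.transvection f v :=
    LinearMap.ext fun _ ↦ rfl
  refine ⟨LinearMap.equivOfDetNeZero _ hne, by rw [hcoe, hdet], fun a ha ↦ ?_, fun W hvW x hx ↦ ?_⟩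
  · have : f a = 0 := LinearMap.congr_fun hf ⟨a, ha⟩
    change LinearMap.transvection f v a = a
    rw [LinearMap.transvection.apply, this, zero_smul, add_zero]
  · exact W.add_mem hx (W.smul_mem _ hvW)

theorem LinearEquiv.exists_extend_det_eq_one {W U U' A : Submodule F V} {v : V} (hv : v ∉ A)
    (hUA : U' ≤ A) {g : V ≃ₗ[F] V} (φ : U ≃ₗ[F] U') (hφ : ∀ u : U, g u = φ u)
    (hgW : ∀ w ∈ W, g w ∈ W) (hW : v ∈ W ∨ W ≤ A) :
    ∃ g : V ≃ₗ[F] V, LinearMap.det (g : V →ₗ[F] V) = 1 ∧ g • W = W ∧ ∀ u : U, g u = φ u := by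
  obtain ⟨h, hdet, hA, hh⟩ := exists_det_eq_of_notMem A hv
    (inv_ne_zero (LinearEquiv.isUnit_det' g).ne_zero)
  refine ⟨g.trans h, ?_, Submodule.smul_eq_of_map_le ?_, fun u ↦ ?_⟩
  · rw [LinearEquiv.coe_trans, LinearMap.det_comp, hdet,
      inv_mul_cancel₀ (LinearEquiv.isUnit_det' g).ne_zero]
  · rintro _ ⟨w, hw, rfl⟩
    change h (g w) ∈ W
    rcases hW with hW | hW
    · exact hh W hW _ (hgW w hw)
    · rw [hA _ (hW (hgW w hw))]
      exact hgW w hw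
  · rw [LinearEquiv.trans_apply, hφ, hA _ (hUA (φ u).2)]

theorem LinearEquiv.exists_extend_of_le {W U U' : Submodule F V} (hW : W ≠ ⊤) (hU : U ≤ W)
    (hU' : U' ≤ W) (φ : U ≃ₗ[F] U') :
    ∃ g : V ≃ₗ[F] V, LinearMap.det (g : V →ₗ[F] V) = 1 ∧ g • W = W ∧ ∀ u : U, g u = φ u := by
  obtain ⟨ψ, hψ⟩ := LinearMap.exists_linearEquiv_comp_eq (i := Submodule.inclusion hU)
    (j := (Submodule.inclusion hU').comp (φ : U →ₗ[F] U')) (Submodule.inclusion_injective hU)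
    ((Submodule.inclusion_injective hU').comp φ.injective)
  obtain ⟨g, hg⟩ := Submodule.exists_linearEquiv_restrict_eq ψ
  obtain ⟨v, -, hv⟩ := SetLike.exists_of_lt hW.lt_top
  refine exists_extend_det_eq_one hv hU' (g := g) φ (fun u : U ↦ ?_) (fun w hw ↦ ?_) (.inr le_rfl)
  · exact (hg (Submodule.inclusion hU u)).symm.trans (congr_arg Subtype.val (hψ u))
  · rw [← hg ⟨w, hw⟩]
    exact (ψ _).2

theorem LinearEquiv.exists_extend_of_disjoint {W U U' : Submodule F V} (hW : W ≠ ⊥)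
    (hU : Disjoint U W) (hU' : Disjoint U' W) (φ : U ≃ₗ[F] U') :
    ∃ g : V ≃ₗ[F] V, LinearMap.det (g : V →ₗ[F] V) = 1 ∧ g • W = W ∧ ∀ u : U, g u = φ u := by
  have hinj : ∀ U' : Submodule F V, Disjoint U' W → ∀ φ : U ≃ₗ[F] U', Function.Injective
      ((U'.subtype.comp (φ : U →ₗ[F] U')).coprod W.subtype) := fun U' h φ ↦ by
    refine (injective_iff_map_eq_zero _).2 fun ⟨a, b⟩ hab ↦ ?_
    have hab : (φ a : V) + b = 0 := hab
    have h₁ : (φ a : V) = 0 := (Submodule.disjoint_def.1 h) _ (φ a).2 (by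
      rw [eq_neg_of_add_eq_zero_left hab]; exact W.neg_mem b.2)
    have h₂ : (b : V) = 0 := by rwa [h₁, zero_add] at hab
    simpa using And.intro h₁ h₂
  obtain ⟨g, hg⟩ := LinearMap.exists_linearEquiv_comp_eq (hinj U hU (.refl F U)) (hinj U' hU' φ)
  obtain ⟨v, hvW, hv⟩ := Submodule.exists_mem_ne_zero_of_ne_bot hW
  refine exists_extend_det_eq_one (v := v) (A := U')
    (fun h ↦ hv (Submodule.disjoint_def.1 hU' v h hvW)) le_rfl (g := g) φ (fun u : U ↦ ?_)
    (fun w hw ↦ ?_) (.inl hvW)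
  · simpa using hg (u, 0)
  · have : g w = w := by simpa using hg (0, ⟨w, hw⟩)
    rwa [this]

theorem LinearEquiv.exists_smul_eq_of_finrank_eq {W W' : Submodule F V} (hW' : W' ≠ ⊤)
    (h : finrank F W = finrank F W') :
    ∃ g : V ≃ₗ[F] V, LinearMap.det (g : V →ₗ[F] V) = 1 ∧ g • W = W' := by
  obtain ⟨g, hg⟩ := Submodule.exists_linearEquiv_restrict_eq (LinearEquiv.ofFinrankEq W W' h)
  obtain ⟨v, -, hv⟩ := SetLike.exists_of_lt hW'.lt_top
  obtain ⟨g, hdet, -, hgφ⟩ := exists_extend_det_eq_one (W := ⊥) hv le_rfl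
    (LinearEquiv.ofFinrankEq W W' h) (fun u ↦ (hg _).symm) (by simp) (.inr bot_le)
  exact ⟨g, hdet, smul_eq_of_forall_apply_eq _ hgφ⟩

end Extend

/-- `g` acts irreducibly on the nonzero invariant subspace `U`. -/
def LinearEquiv.IsIrredOn {F V : Type*} [Field F] [AddCommGroup V] [Module F V]
    (g : V ≃ₗ[F] V) (U : Submodule F V) : Prop :=
  U ≠ ⊥ ∧ U.map (g : V →ₗ[F] V) ≤ U ∧
    ∀ W ≤ U, W.map (g : V →ₗ[F] V) ≤ W → W = ⊥ ∨ W = U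

/-- `g` acts irreducibly on a subspace of more than half the dimension. -/
def LinearEquiv.IsFat {F V : Type*} [Field F] [AddCommGroup V] [Module F V]
    (g : V ≃ₗ[F] V) : Prop :=
  ∃ U : Submodule F V, g.IsIrredOn U ∧ finrank F V < 2 * finrank F U

theorem LinearEquiv.IsIrredOn.le_or_disjoint {F V : Type*} [Field F] [AddCommGroup V]
    [Module F V] {g : V ≃ₗ[F] V} {U W : Submodule F V}
    (hg : g.IsIrredOn U) (hW : g • W = W) : U ≤ W ∨ Disjoint U W := by
  rcases hg.2.2 (U ⊓ W) inf_le_left (le_inf ((Submodule.map_mono inf_le_left).trans hg.2.1)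
    ((Submodule.map_mono inf_le_right).trans hW.le)) with h | h
  · exact .inr (disjoint_iff.2 h)
  · exact .inl (inf_eq_left.1 h)

section Fat

variable {F V : Type*} [Field F] [Finite F] [AddCommGroup V] [Module F V] [FiniteDimensional F V]

theorem LinearEquiv.finrank_mul_card_isIrredOn_le {K : Subgroup (V ≃ₗ[F] V)} {U : Submodule F V}
    (hK : ∀ g ∈ K, g • U = U) (hU : ∀ φ : U ≃ₗ[F] U, ∃ g ∈ K, ∀ u : U, g u = φ u) :
    finrank F U * {g | g ∈ K ∧ g.IsIrredOn U}.ncard ≤ Nat.card K := by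
  have : Finite V := Module.finite_of_finite F
  have : Finite (V ≃ₗ[F] V) := Finite.of_injective _ DFunLike.coe_injective
  have hmem : ∀ g : K, ∀ u ∈ U, ((g : V ≃ₗ[F] V) : V →ₗ[F] V) u ∈ U := fun g u hu ↦ by
    have := Submodule.smul_mem_pointwise_smul u (g : V ≃ₗ[F] V) U hu
    rwa [hK g g.2] at this
  let ρ₀ : K →* End F U :=
    { toFun := fun g ↦ ((g : V ≃ₗ[F] V) : V →ₗ[F] V).restrict (hmem g)
      map_one' := rfl
      map_mul' := fun _ _ ↦ rfl }
  let ρ : K →* (End F U)ˣ := ρ₀.toHomUnits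
  have hρ : Function.Surjective ρ := fun x ↦ by
    obtain ⟨g, hg, h⟩ := hU (LinearMap.GeneralLinearGroup.toLinearEquiv x)
    exact ⟨⟨g, hg⟩, Units.ext (LinearMap.ext fun u ↦ Subtype.ext (h u))⟩
  refine le_trans (Nat.mul_le_mul_left _ ?_)
    (ρ.mul_card_preimage_le hρ (fun x ↦ (x : End F U).IsIrred)
      (End.finrank_mul_card_isIrred_le F U))
  rw [← Nat.card_coe_set_eq]
  refine Nat.card_le_card_of_injective
    (fun g ↦ ⟨⟨g.1, g.2.1⟩, fun W hW ↦ ?_⟩) fun a b h ↦ ?_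
  · have hWg : (W.map U.subtype).map ((g.1 : V ≃ₗ[F] V) : V →ₗ[F] V) ≤ W.map U.subtype := by
      rintro _ ⟨_, ⟨w, hw, rfl⟩, rfl⟩
      exact ⟨_, hW ⟨w, hw, rfl⟩, rfl⟩
    rcases g.2.2.2.2 (W.map U.subtype) (Submodule.map_subtype_le U W) hWg with h | h
    · exact .inl (Submodule.map_injective_of_injective U.injective_subtype (by simpa using h))
    · exact .inr (Submodule.map_injective_of_injective U.injective_subtype (by simpa using h))
  · exact Subtype.ext (congr_arg (fun x ↦ (x.1 : V ≃ₗ[F] V)) h)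

theorem LinearEquiv.ncard_isFat_stabilizer_le {G : Subgroup (V ≃ₗ[F] V)}
    (hG : ∀ g : V ≃ₗ[F] V, LinearMap.det (g : V →ₗ[F] V) = 1 → g ∈ G)
    {W : Submodule F V} (hbot : W ≠ ⊥) (htop : W ≠ ⊤) :
    ({g | g ∈ G ∧ g • W = W ∧ g.IsFat}.ncard : ℝ) ≤
      (∑ e ∈ Finset.Ico (finrank F V / 2 + 1) (finrank F V), (e : ℝ)⁻¹) *
        Nat.card (G ⊓ MulAction.stabilizer (V ≃ₗ[F] V) W : Subgroup (V ≃ₗ[F] V)) := by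
  classical
  have : Finite V := Module.finite_of_finite F
  have : Finite (V ≃ₗ[F] V) := Finite.of_injective _ DFunLike.coe_injective
  have : Finite (Submodule F V) := Finite.of_injective _ SetLike.coe_injective
  have : Fintype (Submodule F V) := Fintype.ofFinite _
  set P : Subgroup (V ≃ₗ[F] V) := G ⊓ MulAction.stabilizer (V ≃ₗ[F] V) W
  let S (e : ℕ) : Finset (Submodule F V) :=
    Finset.univ.filter fun U ↦ finrank F U = e ∧ (U ≤ W ∨ Disjoint U W)
  let T (U : Submodule F V) : Set (V ≃ₗ[F] V) :=
    {g | g ∈ P ⊓ MulAction.stabilizer (V ≃ₗ[F] V) U ∧ g.IsIrredOn U}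
  have hext : ∀ e ∈ Finset.Ico (finrank F V / 2 + 1) (finrank F V), ∀ U ∈ S e, ∀ U' ∈ S e,
      ∀ φ : U ≃ₗ[F] U', ∃ g ∈ P, ∀ u : U, g u = φ u := by
    intro e he U hU U' hU' φ
    simp only [S, Finset.mem_filter, Finset.mem_univ, true_and] at hU hU'
    rw [Finset.mem_Ico] at he
    have hne : ∀ U U' : Submodule F V, finrank F U = e → finrank F U' = e → U ≤ W →
        ¬ Disjoint U' W := fun U U' h h' hle hd ↦ by
      have h₁ := Submodule.finrank_mono hle
      have h₂ := Submodule.finrank_add_finrank_le_of_disjoint hd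
      omega
    obtain ⟨g, hdet, hgW, hg⟩ : ∃ g : V ≃ₗ[F] V, LinearMap.det (g : V →ₗ[F] V) = 1 ∧ g • W = W ∧
        ∀ u : U, g u = φ u := by
      rcases hU.2 with h | h <;> rcases hU'.2 with h' | h'
      · exact exists_extend_of_le htop h h' φ
      · exact absurd h' (hne U U' hU.1 hU'.1 h)
      · exact absurd h (hne U' U hU'.1 hU.1 h')
      · exact exists_extend_of_disjoint hbot h h' φ
    exact ⟨g, ⟨hG g hdet, hgW⟩, hg⟩
  have hTU : ∀ e ∈ Finset.Ico (finrank F V / 2 + 1) (finrank F V), ∀ U ∈ S e,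
      ((T U).ncard : ℝ) ≤ (e : ℝ)⁻¹ * Nat.card P / (S e).card := by
    intro e he U hU
    have hUe : finrank F U = e := by exact (Finset.mem_filter.1 hU).2.1
    have h₁ : e * (T U).ncard ≤
        Nat.card (P ⊓ MulAction.stabilizer (V ≃ₗ[F] V) U : Subgroup (V ≃ₗ[F] V)) := by
      rw [← hUe]
      refine finrank_mul_card_isIrredOn_le (fun g hg ↦ hg.2) fun φ ↦ ?_
      obtain ⟨g, hg, h⟩ := hext e he U hU U hU φ
      exact ⟨g, ⟨hg, smul_eq_of_forall_apply_eq φ h⟩, h⟩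
    have h₂ := Subgroup.card_mul_card_inf_stabilizer_le P (S := (S e : Set (Submodule F V)))
      (x := U) (fun U hU U' hU' ↦ by
        have hf : finrank F U = finrank F U' :=
          (Finset.mem_filter.1 hU).2.1.trans (Finset.mem_filter.1 hU').2.1.symm
        obtain ⟨g, hg, h⟩ := hext e he U hU U' hU' (LinearEquiv.ofFinrankEq U U' hf)
        exact ⟨g, hg, smul_eq_of_forall_apply_eq _ h⟩) hU
    rw [Nat.card_coe_set_eq, Set.ncard_coe_finset] at h₂
    have he0 : (0 : ℝ) < e := by
      rw [Finset.mem_Ico] at he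
      exact_mod_cast (by omega : 0 < e)
    have hS0 : (0 : ℝ) < (S e).card := by exact_mod_cast Finset.card_pos.2 ⟨U, hU⟩
    rw [le_div_iff₀ hS0, inv_mul_eq_div, le_div_iff₀ he0]
    norm_cast
    calc _ = (S e).card * (e * (T U).ncard) := by ring
      _ ≤ _ := (Nat.mul_le_mul_left _ h₁).trans h₂
  have hsub : {g | g ∈ G ∧ g • W = W ∧ g.IsFat} ⊆
      ⋃ e ∈ Finset.Ico (finrank F V / 2 + 1) (finrank F V), ⋃ U ∈ S e, T U := by
    rintro g ⟨hgG, hgW, U, hU, hd⟩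
    have hUW := hU.le_or_disjoint hgW
    have hUtop : U ≠ ⊤ := by
      rintro rfl
      rcases hUW with h | h
      · exact htop (top_le_iff.1 h)
      · exact hbot (top_disjoint.1 h)
    have hlt := Submodule.finrank_lt hUtop
    simp only [Set.mem_iUnion]
    refine ⟨finrank F U, by rw [Finset.mem_Ico]; omega, U, by simp [S, hUW], ⟨⟨hgG, hgW⟩, ?_⟩, hU⟩
    exact Submodule.smul_eq_of_map_le hU.2.1
  have hcard : {g | g ∈ G ∧ g • W = W ∧ g.IsFat}.ncard ≤
      ∑ e ∈ Finset.Ico (finrank F V / 2 + 1) (finrank F V), ∑ U ∈ S e, (T U).ncard :=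
    (Set.ncard_le_ncard hsub (Set.toFinite _)).trans <| (Finset.set_ncard_biUnion_le _ _).trans <|
      Finset.sum_le_sum fun e _ ↦ Finset.set_ncard_biUnion_le _ _
  refine (Nat.cast_le.2 hcard).trans ?_
  push_cast
  rw [Finset.sum_mul]
  refine Finset.sum_le_sum fun e he ↦ (Finset.sum_le_sum (hTU e he)).trans ?_
  rw [Finset.sum_const, nsmul_eq_mul, mul_div_left_comm]
  exact mul_le_of_le_one_right (by positivity) (div_self_le_one _)

end Fat

theorem Finset.sum_inv_Ico_half_le (d : ℕ) :
    ∑ e ∈ Finset.Ico (d / 2 + 1) d, (e : ℝ)⁻¹ ≤ 7 / 10 := by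
  have key : ∀ m : ℕ, 3 ≤ m →
      ∑ e ∈ Finset.Ico (m + 1) (2 * m + 1), (e : ℝ)⁻¹ ≤ 7 / 10 - 1 / (4 * m) := by
    intro m hm
    induction m, hm using Nat.le_induction with
    | base => norm_num [Finset.sum_Ico_succ_top]
    | succ m hm ih =>
      have h : ∑ e ∈ Finset.Ico (m + 1 + 1) (2 * (m + 1) + 1), (e : ℝ)⁻¹ =
          ∑ e ∈ Finset.Ico (m + 1) (2 * m + 1), (e : ℝ)⁻¹ - ((m + 1 : ℕ) : ℝ)⁻¹
            + ((2 * m + 1 : ℕ) : ℝ)⁻¹ + ((2 * m + 2 : ℕ) : ℝ)⁻¹ := by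
        rw [Finset.sum_eq_sum_Ico_succ_bot (show m + 1 < 2 * m + 1 by omega), mul_add, mul_one,
          Finset.sum_Ico_succ_top (by omega), Finset.sum_Ico_succ_top (by omega)]
        ring
      rw [h]
      have hm0 : (0 : ℝ) < m := by exact_mod_cast (by omega : 0 < m)
      have : 1 / (4 * (m : ℝ)) - 1 / (4 * ((m + 1 : ℕ) : ℝ)) - (- ((m + 1 : ℕ) : ℝ)⁻¹
            + ((2 * m + 1 : ℕ) : ℝ)⁻¹ + ((2 * m + 2 : ℕ) : ℝ)⁻¹) =
            1 / (4 * m * (m + 1) * (2 * m + 1)) := by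
        push_cast
        field_simp
        ring
      have h' : 0 < 1 / (4 * (m : ℝ) * (m + 1) * (2 * m + 1)) := by positivity
      linarith
  have hsub : ∑ e ∈ Finset.Ico (d / 2 + 1) d, (e : ℝ)⁻¹ ≤
      ∑ e ∈ Finset.Ico (d / 2 + 1) (2 * (d / 2) + 1), (e : ℝ)⁻¹ :=
    Finset.sum_le_sum_of_subset_of_nonneg (Finset.Ico_subset_Ico_right (by omega))
      fun _ _ _ ↦ by positivity
  refine hsub.trans ?_
  rcases Nat.lt_or_ge (d / 2) 3 with h | h
  · interval_cases d / 2 <;> norm_num [Finset.sum_Ico_succ_top]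
  · have := key _ h
    have : (0 : ℝ) ≤ 1 / (4 * (d / 2 : ℕ)) := by positivity
    linarith

theorem Submodule.card_finrank_eq_one (F V : Type*) [Field F] [Finite F] [AddCommGroup V]
    [Module F V] :
    Nat.card {W : Submodule F V // finrank F W = 1} =
      ∑ i ∈ Finset.range (finrank F V), Nat.card F ^ i := by
  rw [← Projectivization.card_of_finrank F V rfl]
  exact Nat.card_congr (Projectivization.equivSubmodule F V).symm

section Grassmannian

variable (F V : Type*) [Field F] [Finite F] [AddCommGroup V] [Module F V] [FiniteDimensional F V]

theorem Submodule.card_finrank_add_one_eq :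
    Nat.card {W : Submodule F V // finrank F W + 1 = finrank F V} =
      ∑ i ∈ Finset.range (finrank F V), Nat.card F ^ i := by
  rw [← Subspace.dual_finrank_eq (K := F), ← card_finrank_eq_one F (Dual F V)]
  refine Nat.card_congr ((Subspace.orderIsoFiniteDimensional.toEquiv.trans
    OrderDual.ofDual).subtypeEquiv fun W ↦ ?_)
  have := Subspace.finrank_add_finrank_dualAnnihilator_eq W
  change _ ↔ finrank F W.dualAnnihilator = 1
  rw [Subspace.dual_finrank_eq]
  omega

theorem Submodule.pow_mul_le_card_finrank_eq {k : ℕ} (hk : k ≤ finrank F V) :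
    Nat.card F ^ (k * (finrank F V - k)) ≤
      Nat.card {W : Submodule F V // finrank F W = k} := by
  have : Finite V := Module.finite_of_finite F
  have : Finite (Submodule F V) := Finite.of_injective _ SetLike.coe_injective
  obtain ⟨W, hW⟩ : ∃ W : Submodule F V, finrank F W = k :=
    ⟨_, (finrank_span_eq_card ((finBasis F V).linearIndependent.comp (Fin.castLE hk)
      (Fin.castLE_injective hk))).trans (Fintype.card_fin k)⟩
  obtain ⟨C, hC⟩ := Submodule.exists_isCompl W
  have hrank : finrank F (W →ₗ[F] C) = k * (finrank F V - k) := by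
    rw [Module.finrank_linearMap, hW]
    congr
    have := Submodule.finrank_add_eq_of_isCompl hC
    omega
  rw [← hrank, ← Module.natCard_eq_pow_finrank]
  have key : ∀ (f g : W →ₗ[F] C) (v w : W), (v : V) + f v = w + g w → v = w ∧ f v = g w := by
    intro f g v w h
    have h : W.prodEquivOfIsCompl C hC (v, f v) = W.prodEquivOfIsCompl C hC (w, g w) := by
      simpa using h
    exact Prod.ext_iff.1 ((W.prodEquivOfIsCompl C hC).injective h)
  have hinj : ∀ f : W →ₗ[F] C, Function.Injective (W.subtype + C.subtype.comp f) :=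
    fun f v w h ↦ (key f f v w h).1
  refine Nat.card_le_card_of_injective
    (fun f ↦ ⟨LinearMap.range (W.subtype + C.subtype.comp f), by
      rw [LinearMap.finrank_range_of_inj (hinj f), hW]⟩) fun f g h ↦ ?_
  ext1 v
  have hv : (W.subtype + C.subtype.comp f) v ∈ LinearMap.range (W.subtype + C.subtype.comp g) := by
    rw [← Subtype.mk.inj h]
    exact ⟨v, rfl⟩
  obtain ⟨w, hw⟩ := hv
  obtain ⟨rfl, h'⟩ := key g f w v hw
  exact h'.symm

end Grassmannian

theorem Nat.mul_add_one_lt_two_mul_pow {q : ℕ} (hq : 2 ≤ q) (n : ℕ) :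
    n * (q + 1) < 2 * q ^ n := by
  induction n with
  | zero => simp
  | succ n ih =>
    rcases n.eq_zero_or_pos with rfl | hn
    · simp; omega
    calc (n + 1) * (q + 1) ≤ 2 * (n * (q + 1)) := by nlinarith
      _ < 2 * (2 * q ^ n) := by omega
      _ ≤ 2 * (q * q ^ n) := by gcongr
      _ = 2 * q ^ (n + 1) := by ring

section Reducible

variable {F V : Type*} [Field F] [Finite F] [AddCommGroup V] [Module F V] [FiniteDimensional F V]

variable (F V) in
theorem Submodule.sum_inv_card_finrank_eq_lt (hd : 3 ≤ finrank F V) :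
    ∑ k ∈ Finset.Ico 1 (finrank F V), (Nat.card {W : Submodule F V // finrank F W = k} : ℝ)⁻¹ <
      2 * ((Nat.card F : ℝ) ^ (finrank F V - 1))⁻¹ := by
  obtain ⟨n, hn⟩ : ∃ n, finrank F V = n + 3 := ⟨_, (Nat.sub_add_cancel hd).symm⟩
  have hq : 2 ≤ Nat.card F := Finite.one_lt_card
  set q := Nat.card F
  have hq0 : (0 : ℝ) < q := by exact_mod_cast (by omega : 0 < q)
  let N (k : ℕ) : ℕ := Nat.card {W : Submodule F V // finrank F W = k}
  change ∑ k ∈ _, (N k : ℝ)⁻¹ < _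
  have hgeom : q ^ (n + 1) * (q + 1) ≤ ∑ i ∈ Finset.range (n + 3), q ^ i := by
    rw [Finset.sum_range_succ, Finset.sum_range_succ, pow_succ q (n + 1)]
    nlinarith [Nat.zero_le (∑ i ∈ Finset.range (n + 1), q ^ i)]
  have h₁ : (N 1 : ℝ)⁻¹ ≤ ((q : ℝ) ^ (n + 1) * (q + 1))⁻¹ := by
    refine inv_anti₀ (by positivity) ?_
    have := hgeom.trans_eq ((card_finrank_eq_one F V).trans (by rw [hn])).symm
    exact_mod_cast this
  have h₂ : (N (n + 2) : ℝ)⁻¹ ≤ ((q : ℝ) ^ (n + 1) * (q + 1))⁻¹ := by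
    refine inv_anti₀ (by positivity) ?_
    have h : N (n + 2) = Nat.card {W : Submodule F V // finrank F W + 1 = finrank F V} := by
      simp only [N, hn, show n + 3 = n + 2 + 1 from rfl, Nat.add_right_cancel_iff]
    have := hgeom.trans_eq ((card_finrank_add_one_eq F V).trans (by rw [hn])).symm
    rw [h]
    exact_mod_cast this
  have h₃ : ∀ k ∈ Finset.Ico 2 (n + 2), (N k : ℝ)⁻¹ ≤ ((q : ℝ) ^ (2 * (n + 1)))⁻¹ := by
    intro k hk
    rw [Finset.mem_Ico] at hk
    refine inv_anti₀ (by positivity) ?_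
    have hexp : 2 * (n + 1) ≤ k * (finrank F V - k) := by
      obtain ⟨j, hj⟩ := Nat.exists_eq_add_of_le hk.1
      obtain ⟨l, hl⟩ := Nat.exists_eq_add_of_lt hk.2
      rw [hn, show n + 3 - k = l + 2 by omega, hj]
      nlinarith [Nat.zero_le (j * l)]
    exact_mod_cast (Nat.pow_le_pow_right (by omega) hexp).trans
      (pow_mul_le_card_finrank_eq F V (k := k) (by omega))
  have hmain : (n : ℝ) * (q + 1) < 2 * q ^ n := by
    exact_mod_cast Nat.mul_add_one_lt_two_mul_pow hq n
  rw [hn, Finset.sum_eq_sum_Ico_succ_bot (by omega), Finset.sum_Ico_succ_top (by omega)]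
  have h₄ := Finset.sum_le_sum h₃
  rw [Finset.sum_const, Nat.card_Ico, nsmul_eq_mul, Nat.add_sub_cancel] at h₄
  have h₅ : 2 * ((q : ℝ) ^ (n + 2))⁻¹ - 2 * ((q : ℝ) ^ (n + 1) * (q + 1))⁻¹ -
      n * ((q : ℝ) ^ (2 * (n + 1)))⁻¹ =
      (2 * q ^ n - n * (q + 1)) * ((q : ℝ) ^ (2 * (n + 1)) * (q + 1))⁻¹ := by
    field_simp
    ring
  have h₆ : 0 < (2 * q ^ n - n * (q + 1)) * ((q : ℝ) ^ (2 * (n + 1)) * (q + 1))⁻¹ :=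
    mul_pos (sub_pos.2 hmain) (by positivity)
  have h₇ : n + 3 - 1 = n + 2 := rfl
  rw [h₇]
  change (N 1 : ℝ)⁻¹ + (_ + (N (n + 2) : ℝ)⁻¹) < _
  linarith

theorem LinearEquiv.ncard_isFat_pairs_lt {G : Subgroup (V ≃ₗ[F] V)}
    (hG : ∀ g : V ≃ₗ[F] V, LinearMap.det (g : V →ₗ[F] V) = 1 → g ∈ G) (hd : 3 ≤ finrank F V) :
    ({p : (V ≃ₗ[F] V) × (V ≃ₗ[F] V) | p.1 ∈ G ∧ p.2 ∈ G ∧ p.1.IsFat ∧ p.2.IsFat ∧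
        ∃ W : Submodule F V, W ≠ ⊥ ∧ W ≠ ⊤ ∧ p.1 • W = W ∧ p.2 • W = W}.ncard : ℝ) <
      ((Nat.card F : ℝ) ^ (finrank F V - 1))⁻¹ * (Nat.card G : ℝ) ^ 2 := by
  classical
  have : Finite V := Module.finite_of_finite F
  have : Finite (V ≃ₗ[F] V) := Finite.of_injective _ DFunLike.coe_injective
  have : Finite (Submodule F V) := Finite.of_injective _ SetLike.coe_injective
  have : Fintype (Submodule F V) := Fintype.ofFinite _
  let A (W : Submodule F V) : Set (V ≃ₗ[F] V) := {g | g ∈ G ∧ g • W = W ∧ g.IsFat}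
  let X : Finset (Submodule F V) := Finset.univ.filter fun W ↦ W ≠ ⊥ ∧ W ≠ ⊤
  let Y (k : ℕ) : Finset (Submodule F V) := X.filter fun W ↦ finrank F W = k
  let N (k : ℕ) : ℕ := Nat.card {W : Submodule F V // finrank F W = k}
  have hX : ∀ W ∈ X, finrank F W ∈ Finset.Ico 1 (finrank F V) := fun W hW ↦ by
    simp only [X, Finset.mem_filter, Finset.mem_univ, true_and] at hW
    exact Finset.mem_Ico.2 ⟨Submodule.one_le_finrank_iff.2 hW.1, Submodule.finrank_lt hW.2⟩
  have hA : ∀ W ∈ X, ((A W).ncard : ℝ) * N (finrank F W) ≤ 7 / 10 * Nat.card G := by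
    intro W hW
    have hlt := (Finset.mem_Ico.1 (hX W hW)).2
    simp only [X, Finset.mem_filter, Finset.mem_univ, true_and] at hW
    have h₁ := ncard_isFat_stabilizer_le hG hW.1 hW.2
    have h₂ := Subgroup.card_mul_card_inf_stabilizer_le G
      (S := {W' : Submodule F V | finrank F W' = finrank F W}) (x := W) (fun U hU U' hU' ↦ by
        have hne : U' ≠ ⊤ := by
          rintro rfl
          rw [Set.mem_ofPred_eq, finrank_top] at hU'
          omega
        obtain ⟨g, hdet, hg⟩ := exists_smul_eq_of_finrank_eq hne (hU.trans hU'.symm)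
        exact ⟨g, hG g hdet, hg⟩) rfl
    have h₂ : (N (finrank F W) : ℝ) *
        Nat.card (G ⊓ MulAction.stabilizer (V ≃ₗ[F] V) W : Subgroup (V ≃ₗ[F] V)) ≤ Nat.card G := by
      exact_mod_cast h₂
    calc ((A W).ncard : ℝ) * N (finrank F W)
        ≤ (7 / 10 * Nat.card (G ⊓ MulAction.stabilizer (V ≃ₗ[F] V) W : Subgroup (V ≃ₗ[F] V))) *
          N (finrank F W) := by
          gcongr
          exact h₁.trans (by gcongr; exact Finset.sum_inv_Ico_half_le _)
      _ ≤ _ := by linarith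
  have hsub : {p : (V ≃ₗ[F] V) × (V ≃ₗ[F] V) | p.1 ∈ G ∧ p.2 ∈ G ∧ p.1.IsFat ∧ p.2.IsFat ∧
        ∃ W : Submodule F V, W ≠ ⊥ ∧ W ≠ ⊤ ∧ p.1 • W = W ∧ p.2 • W = W} ⊆
      ⋃ W ∈ X, A W ×ˢ A W := by
    rintro p ⟨h₁, h₂, hf₁, hf₂, W, hbot, htop, hW₁, hW₂⟩
    simp only [Set.mem_iUnion]
    exact ⟨W, by simp [X, hbot, htop], ⟨h₁, hW₁, hf₁⟩, ⟨h₂, hW₂, hf₂⟩⟩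
  have hcard := (Set.ncard_le_ncard hsub (Set.toFinite _)).trans (Finset.set_ncard_biUnion_le _ _)
  have hN : ∀ k ∈ Finset.Ico 1 (finrank F V), 0 < N k := fun k hk ↦
    (pow_pos Nat.card_pos _).trans_le
      (Submodule.pow_mul_le_card_finrank_eq F V (Finset.mem_Ico.1 hk).2.le)
  have hsum : ∀ k ∈ Finset.Ico 1 (finrank F V),
      ∑ W ∈ Y k, ((A W ×ˢ A W).ncard : ℝ) ≤
        49 / 100 * (Nat.card G : ℝ) ^ 2 * (N k : ℝ)⁻¹ := by
    intro k hk
    have hk0 : (0 : ℝ) < N k := by exact_mod_cast hN k hk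
    have hcardX : ((Y k).card : ℝ) ≤ N k := by
      have : N k = (Finset.univ.filter fun W : Submodule F V ↦ finrank F W = k).card := by
        simp only [N, Nat.card_eq_fintype_card, Fintype.card_subtype]
      rw [this]
      exact_mod_cast Finset.card_le_card (Finset.filter_subset_filter _ (Finset.subset_univ X))
    calc ∑ W ∈ Y k, ((A W ×ˢ A W).ncard : ℝ)
        ≤ ∑ W ∈ Y k, (7 / 10 * Nat.card G / N k : ℝ) ^ 2 := by
          refine Finset.sum_le_sum fun W hW ↦ ?_
          rw [Finset.mem_filter] at hW
          have := hA W hW.1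
          rw [hW.2, ← le_div_iff₀ hk0] at this
          rw [Set.ncard_prod, Nat.cast_mul, ← sq]
          gcongr
      _ = (Y k).card * (7 / 10 * Nat.card G / N k : ℝ) ^ 2 := by
          rw [Finset.sum_const, nsmul_eq_mul]
      _ ≤ N k * (7 / 10 * Nat.card G / N k : ℝ) ^ 2 := by gcongr
      _ = _ := by field_simp; ring
  have hG0 : (0 : ℝ) < Nat.card G := by exact_mod_cast Nat.card_pos
  calc _ ≤ ∑ W ∈ X, ((A W ×ˢ A W).ncard : ℝ) := by exact_mod_cast hcard
    _ = ∑ k ∈ Finset.Ico 1 (finrank F V), ∑ W ∈ Y k, ((A W ×ˢ A W).ncard : ℝ) :=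
      (Finset.sum_fiberwise_of_maps_to hX _).symm
    _ ≤ ∑ k ∈ Finset.Ico 1 (finrank F V), 49 / 100 * (Nat.card G : ℝ) ^ 2 * (N k : ℝ)⁻¹ :=
      Finset.sum_le_sum hsum
    _ = 49 / 100 * (Nat.card G : ℝ) ^ 2 * ∑ k ∈ Finset.Ico 1 (finrank F V), (N k : ℝ)⁻¹ := by
      rw [Finset.mul_sum]
    _ < 49 / 100 * (Nat.card G : ℝ) ^ 2 * (2 * ((Nat.card F : ℝ) ^ (finrank F V - 1))⁻¹) := by
      gcongr
      exact Submodule.sum_inv_card_finrank_eq_lt F V hd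
    _ ≤ _ := by
      have : 0 ≤ ((Nat.card F : ℝ) ^ (finrank F V - 1))⁻¹ * (Nat.card G : ℝ) ^ 2 := by positivity
      linarith

end Reducible

/-- Theorem 1: for `SL(d,q) ≤ G ≤ GL(d,q)` with `d ≥ 3`, the proportion of reducible fat
pairs among all pairs in `G × G` is less than `q^{-d+1}`. -/
theorem redandfat_lt (q d : ℕ) (hq : IsPrimePow q) (hd : 3 ≤ d)
    (F : Type) [Field F] [Fintype F] [DecidableEq F] (hF : Fintype.card F = q)
    (G : Subgroup (GL (Fin d) F))
    (hG : ∀ g : GL (Fin d) F, (g : Matrix (Fin d) (Fin d) F).det = 1 → g ∈ G) :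
    (Nat.card {p : G × G //
        IsFat (p.1 : GL (Fin d) F) ∧ IsFat (p.2 : GL (Fin d) F) ∧
        IsRedPair (p.1 : GL (Fin d) F) (p.2 : GL (Fin d) F)} : ℝ) <
      (q : ℝ) ^ (-(d : ℤ) + 1) * (Nat.card G : ℝ) ^ 2 := by
  let f : GL (Fin d) F ≃* ((Fin d → F) ≃ₗ[F] (Fin d → F)) :=
    Matrix.GeneralLinearGroup.toLin.trans (LinearMap.GeneralLinearGroup.generalLinearEquiv F _)
  have hf : ∀ g : GL (Fin d) F, (f g : (Fin d → F) →ₗ[F] (Fin d → F)) =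
      Matrix.toLin' (g : Matrix (Fin d) (Fin d) F) := fun _ ↦ rfl
  have : Finite ((Fin d → F) ≃ₗ[F] (Fin d → F)) := Finite.of_injective _ DFunLike.coe_injective
  have hfat : ∀ g : GL (Fin d) F, IsFat g → (f g).IsFat := fun g ⟨U, hU, h⟩ ↦
    ⟨U, hU, by simpa using h⟩
  have key := LinearEquiv.ncard_isFat_pairs_lt (G := G.map f.toMonoidHom) (fun g hg ↦ by
    refine ⟨f.symm g, hG _ ?_, f.apply_symm_apply g⟩
    rw [← LinearMap.det_toLin', ← hf, f.apply_symm_apply, hg]) (by simpa using hd)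
  rw [finrank_fin_fun, Nat.card_eq_fintype_card (α := F), hF,
    ← Nat.card_congr (G.equivMapOfInjective f.toMonoidHom f.injective).toEquiv] at key
  have hpow : (q : ℝ) ^ (-(d : ℤ) + 1) = ((q : ℝ) ^ (d - 1))⁻¹ := by
    rw [← zpow_natCast, ← zpow_neg, Nat.cast_sub (by omega)]
    congr 1
    push_cast
    ring
  rw [hpow]
  refine lt_of_le_of_lt ?_ key
  rw [← Nat.card_coe_set_eq, Nat.cast_le]
  refine Nat.card_le_card_of_injective
    (fun p ↦ ⟨(f p.1.1, f p.1.2), ⟨_, p.1.1.2, rfl⟩, ⟨_, p.1.2.2, rfl⟩, hfat _ p.2.1,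
      hfat _ p.2.2.1, ?_⟩) fun a b h ↦ ?_
  · obtain ⟨W, hbot, htop, h₁, h₂⟩ := p.2.2.2
    exact ⟨W, hbot, htop, Submodule.smul_eq_of_map_le h₁, Submodule.smul_eq_of_map_le h₂⟩
  · have h := Prod.ext_iff.1 (Subtype.ext_iff.1 h)
    exact Subtype.ext (Prod.ext (Subtype.ext (f.injective h.1)) (Subtype.ext (f.injective h.2)))
end

section
/- Let d ≥ 3 and SL(d,q) ≤ G ≤ GL(d,q). Among all fat pairs in G × G (pairs (g_1,g_2) where each g_i has an irreducible F_q⟨g_i⟩-submodule of F_q^d of dimension > d/2), the proportion of pairs that generate a reducible subgroup is strictly less than 2 q^{-(d-1)}. -/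
section FatPairs

open Module
open scoped Pointwise

variable {F V : Type*} [Field F] [AddCommGroup V] [Module F V]

theorem smul_submodule_le_iff {g : V ≃ₗ[F] V} {W W' : Submodule F V} :
    g • W ≤ W' ↔ ∀ w ∈ W, g w ∈ W' := by
  constructor
  · intro h w hw
    exact h (Submodule.smul_mem_pointwise_smul w g W hw)
  · intro h x hx
    obtain ⟨w, hw, rfl⟩ := (Submodule.mem_smul_pointwise_iff_exists _ _ _).1 hx
    exact h w hw

theorem finrank_smul_submodule (g : V ≃ₗ[F] V) (W : Submodule F V) :
    finrank F (g • W : Submodule F V) = finrank F W :=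
  LinearEquiv.finrank_map_eq g W

theorem smul_submodule_eq_of_le [FiniteDimensional F V] {g : V ≃ₗ[F] V} {W W' : Submodule F V}
    (h : g • W ≤ W') (hd : finrank F W = finrank F W') : g • W = W' :=
  Submodule.eq_of_le_of_finrank_eq h (by rw [finrank_smul_submodule, hd])

/-- The stabilizer of a subspace acts with arbitrary determinant: dilations along a line. -/
theorem exists_det_eq_fixing [FiniteDimensional F V] {U C W : Submodule F V} (hUC : Disjoint U C)
    (hW : W ≤ C) (hW0 : W ≠ ⊥) {c : F} (hc : c ≠ 0) :
    ∃ t : V ≃ₗ[F] V, LinearMap.det (t : V →ₗ[F] V) = c ∧ (∀ u ∈ U, t u = u) ∧ t • C = C ∧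
      t • W = W := by
  obtain ⟨w, hw, hw0⟩ := Submodule.exists_mem_ne_zero_of_ne_bot hW0
  have hwU : w ∉ U := fun h => hw0 (Submodule.disjoint_def.1 hUC w h (hW hw))
  obtain ⟨f, hf, hUf⟩ := Submodule.exists_le_ker_of_notMem hwU
  have hdet : LinearMap.det (LinearMap.transvection f (((c - 1) * (f w)⁻¹) • w)) = c := by
    rw [LinearMap.transvection.det, map_smul, smul_eq_mul, mul_assoc, inv_mul_cancel₀ hf]
    ring
  have hmem : ∀ Y : Submodule F V, w ∈ Y → ∀ y ∈ Y,
      LinearMap.transvection f (((c - 1) * (f w)⁻¹) • w) y ∈ Y := fun Y hwY y hy => by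
    rw [LinearMap.transvection.apply]
    exact Y.add_mem hy (Y.smul_mem _ (Y.smul_mem _ hwY))
  let t := LinearMap.equivOfDetNeZero (LinearMap.transvection f (((c - 1) * (f w)⁻¹) • w))
    (by rw [hdet]; exact hc)
  have ht : ∀ v, t v = LinearMap.transvection f (((c - 1) * (f w)⁻¹) • w) v := fun v => rfl
  refine ⟨t, ?_, ?_, ?_, ?_⟩
  · rw [← hdet]; congr 1
  · intro u hu
    rw [ht, LinearMap.transvection.apply, LinearMap.mem_ker.1 (hUf hu)]
    simp
  · exact smul_submodule_eq_of_le (smul_submodule_le_iff.2 (hmem C (hW hw))) rfl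
  · exact smul_submodule_eq_of_le (smul_submodule_le_iff.2 (hmem W hw)) rfl

/-- Transitivity of the special linear group of `C` on the subspaces of `C` of given dimension. -/
theorem exists_det_one_smul_eq [FiniteDimensional F V] {U C W W' : Submodule F V}
    (hUC : IsCompl U C) (hW : W ≤ C) (hW' : W' ≤ C) (hd : finrank F W = finrank F W') :
    ∃ h : V ≃ₗ[F] V, LinearMap.det (h : V →ₗ[F] V) = 1 ∧ (∀ u ∈ U, h u = u) ∧ h • C = C ∧
      h • W = W' := by
  rcases eq_or_ne W ⊥ with rfl | hW0
  · refine ⟨1, ?_, fun u _ => rfl, one_smul _ _, ?_⟩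
    · exact LinearMap.det_id
    · rw [one_smul]
      exact (Submodule.finrank_eq_zero.1 (by rw [← hd, finrank_bot])).symm
  let f : (W.comap C.subtype) ≃ₗ[F] (W'.comap C.subtype) :=
    (Submodule.comapSubtypeEquivOfLe hW).trans
      ((LinearEquiv.ofFinrankEq _ _ hd).trans (Submodule.comapSubtypeEquivOfLe hW').symm)
  obtain ⟨g, hg⟩ := Submodule.exists_linearEquiv_restrict_eq f
  let e := Submodule.prodEquivOfIsCompl U C hUC
  let h₀ : V ≃ₗ[F] V := e.symm.trans (((LinearEquiv.refl F U).prodCongr g).trans e)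
  have h₀U : ∀ u ∈ U, h₀ u = u := fun u hu => by
    have : e.symm u = (⟨u, hu⟩, 0) :=
      Submodule.prodEquivOfIsCompl_symm_apply_left U C hUC ⟨u, hu⟩
    simp only [h₀, LinearEquiv.trans_apply, this]
    simp [e]
  have h₀C : ∀ c (hc : c ∈ C), h₀ c = g ⟨c, hc⟩ := fun c hc => by
    have : e.symm c = (0, ⟨c, hc⟩) :=
      Submodule.prodEquivOfIsCompl_symm_apply_right U C hUC ⟨c, hc⟩
    simp only [h₀, LinearEquiv.trans_apply, this]
    simp [e]
  obtain ⟨t, htd, htU, htC, htW⟩ := exists_det_eq_fixing hUC.disjoint hW hW0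
    (c := (LinearMap.det (h₀ : V →ₗ[F] V))⁻¹) (inv_ne_zero (LinearEquiv.isUnit_det' h₀).ne_zero)
  have h₀W : h₀ • W = W' := by
    refine smul_submodule_eq_of_le (smul_submodule_le_iff.2 fun w hw => ?_) hd
    rw [h₀C w (hW hw), ← hg ⟨⟨w, hW hw⟩, hw⟩]
    exact (f ⟨⟨w, hW hw⟩, hw⟩).2
  refine ⟨h₀ * t, ?_, fun u hu => ?_, ?_, ?_⟩
  · have : ((h₀ * t : V ≃ₗ[F] V) : V →ₗ[F] V) = (h₀ : V →ₗ[F] V) ∘ₗ (t : V →ₗ[F] V) := rfl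
    rw [this, LinearMap.det_comp, htd, mul_inv_cancel₀ (LinearEquiv.isUnit_det' h₀).ne_zero]
  · rw [LinearEquiv.mul_apply, htU u hu, h₀U u hu]
  · rw [mul_smul, htC]
    refine smul_submodule_eq_of_le (smul_submodule_le_iff.2 fun c hc => ?_) rfl
    rw [h₀C c hc]
    exact (g _).2
  · rw [mul_smul, htW, h₀W]

/-- An irreducible invariant subspace of more than half of the dimension. -/
structure IsFatSubmodule (g : V ≃ₗ[F] V) (U : Submodule F V) : Prop where
  ne_bot : U ≠ ⊥
  smul_eq : g • U = U
  eq_bot_or_eq : ∀ W ≤ U, g • W = W → W = ⊥ ∨ W = U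
  lt : finrank F V < 2 * finrank F U

theorem aeval_mem_of_smul_eq {g : V ≃ₗ[F] V} {W : Submodule F V} (h : g • W = W)
    (f : Polynomial F) {w : V} (hw : w ∈ W) : Polynomial.aeval (g : V →ₗ[F] V) f w ∈ W := by
  have hg : ∀ n : ℕ, ((g : V →ₗ[F] V) ^ n) w ∈ W := fun n => by
    induction n with
    | zero => simpa using hw
    | succ n ih =>
      rw [pow_succ', Module.End.mul_apply]
      exact smul_submodule_le_iff.1 h.le _ ih
  induction f using Polynomial.induction_on' with
  | add p q hp hq => rw [map_add]; exact W.add_mem hp hq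
  | monomial n a =>
    rw [Polynomial.aeval_monomial, Module.End.mul_apply, Module.algebraMap_end_apply]
    exact W.smul_mem a (hg n)

theorem aeval_comm (g : V ≃ₗ[F] V) (f : Polynomial F) (v : V) :
    Polynomial.aeval (g : V →ₗ[F] V) f (g v) = g (Polynomial.aeval (g : V →ₗ[F] V) f v) := by
  have := congrArg (fun p => Polynomial.aeval (g : V →ₗ[F] V) p v) (mul_comm f Polynomial.X)
  simpa [map_mul] using this

/-- The evaluation of polynomials in `g` at a vector. -/
noncomputable def polyOrbit (g : V ≃ₗ[F] V) (v : V) : Polynomial F →ₗ[F] V :=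
  (LinearMap.applyₗ v).comp (Polynomial.aeval (g : V →ₗ[F] V)).toLinearMap

theorem polyOrbit_apply (g : V ≃ₗ[F] V) (v : V) (f : Polynomial F) :
    polyOrbit g v f = Polynomial.aeval (g : V →ₗ[F] V) f v := rfl

theorem smul_range_polyOrbit [FiniteDimensional F V] (g : V ≃ₗ[F] V) (v : V) :
    g • LinearMap.range (polyOrbit g v) = LinearMap.range (polyOrbit g v) := by
  refine smul_submodule_eq_of_le (smul_submodule_le_iff.2 ?_) rfl
  rintro _ ⟨f, rfl⟩
  refine ⟨Polynomial.X * f, ?_⟩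
  rw [polyOrbit_apply, polyOrbit_apply, map_mul, Polynomial.aeval_X]
  rfl

theorem mem_range_polyOrbit (g : V ≃ₗ[F] V) (v : V) : v ∈ LinearMap.range (polyOrbit g v) :=
  ⟨1, by simp [polyOrbit_apply]⟩

theorem smul_inf_of_smul_eq [FiniteDimensional F V] {g : V ≃ₗ[F] V} {W W' : Submodule F V}
    (h : g • W = W) (h' : g • W' = W') : g • (W ⊓ W') = W ⊓ W' :=
  smul_submodule_eq_of_le (smul_submodule_le_iff.2 fun w hw =>
    ⟨smul_submodule_le_iff.1 h.le w hw.1, smul_submodule_le_iff.1 h'.le w hw.2⟩) rfl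

namespace IsFatSubmodule

variable [FiniteDimensional F V] {g : V ≃ₗ[F] V} {U : Submodule F V}

theorem disjoint_or_le (hU : IsFatSubmodule g U) {W : Submodule F V} (hW : g • W = W) :
    Disjoint W U ∨ U ≤ W := by
  rcases hU.eq_bot_or_eq (W ⊓ U) inf_le_right (smul_inf_of_smul_eq hW hU.smul_eq) with h | h
  · exact Or.inl (disjoint_iff.2 h)
  · exact Or.inr (inf_eq_right.1 h)

theorem le_of_finrank_lt (hU : IsFatSubmodule g U) {W : Submodule F V} (hW : g • W = W)
    (hd : finrank F V < finrank F W + finrank F U) : U ≤ W :=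
  (hU.disjoint_or_le hW).resolve_left fun h =>
    absurd (Submodule.finrank_add_finrank_le_of_disjoint h) (by omega)

theorem unique (hU : IsFatSubmodule g U) {U' : Submodule F V} (hU' : IsFatSubmodule g U') :
    U = U' := by
  have h1 := hU.lt
  have h2 := hU'.lt
  exact le_antisymm (hU.le_of_finrank_lt hU'.smul_eq (by omega))
    (hU'.le_of_finrank_lt hU.smul_eq (by omega))

theorem aeval_eq_zero (hU : IsFatSubmodule g U) {f : Polynomial F} {u : V} (hu : u ∈ U)
    (hu0 : u ≠ 0) (hf : Polynomial.aeval (g : V →ₗ[F] V) f u = 0) {v : V} (hv : v ∈ U) :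
    Polynomial.aeval (g : V →ₗ[F] V) f v = 0 := by
  have hk : g • LinearMap.ker (Polynomial.aeval (g : V →ₗ[F] V) f) =
      LinearMap.ker (Polynomial.aeval (g : V →ₗ[F] V) f) := by
    refine smul_submodule_eq_of_le (smul_submodule_le_iff.2 fun w hw => ?_) rfl
    rw [LinearMap.mem_ker] at hw ⊢
    rw [aeval_comm, hw, map_zero]
  rcases hU.disjoint_or_le hk with h | h
  · exact absurd (Submodule.disjoint_def.1 h u (LinearMap.mem_ker.2 hf) hu) hu0
  · exact LinearMap.mem_ker.1 (h hv)

/-- The `p`-torsion, `p` the minimal polynomial on `U`, is `U` itself. -/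
theorem exists_ker_aeval_eq (hU : IsFatSubmodule g U) :
    ∃ p : Polynomial F, LinearMap.ker (Polynomial.aeval (g : V →ₗ[F] V) p) = U := by
  obtain ⟨u, hu, hu0⟩ := Submodule.exists_mem_ne_zero_of_ne_bot hU.ne_bot
  let I : Ideal (Polynomial F) :=
    { carrier := {f | Polynomial.aeval (g : V →ₗ[F] V) f u = 0}
      add_mem' := fun {a b} ha hb => by
        simp only [Set.mem_ofPred_eq] at ha hb ⊢
        rw [map_add, LinearMap.add_apply, ha, hb, add_zero]
      zero_mem' := by simp
      smul_mem' := fun c a ha => by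
        simp only [Set.mem_ofPred_eq, smul_eq_mul] at ha ⊢
        rw [map_mul, Module.End.mul_apply, ha, map_zero] }
  have hI : ∀ f, f ∈ I ↔ Polynomial.aeval (g : V →ₗ[F] V) f u = 0 := fun f => Iff.rfl
  have hIp : I.IsPrime := by
    refine ⟨fun h => hu0 ?_, fun {a b} hab => ?_⟩
    · have : (1 : Polynomial F) ∈ I := h ▸ Submodule.mem_top
      simpa [hI] using this
    · by_contra! h
      have hbu := aeval_mem_of_smul_eq hU.smul_eq b hu
      refine h.1 (hU.aeval_eq_zero hbu h.2 ?_ hu)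
      rw [← Module.End.mul_apply, ← map_mul]
      exact hab
  have hI0 : I ≠ ⊥ := fun h => by
    have : (LinearMap.charpoly (g : V →ₗ[F] V)) ∈ I := by
      rw [hI, LinearMap.aeval_self_charpoly, LinearMap.zero_apply]
    rw [h] at this
    exact (LinearMap.charpoly_monic (g : V →ₗ[F] V)).ne_zero this
  have hp := (Submodule.IsPrincipal.prime_generator_of_isPrime I hI0).irreducible
  set p := Submodule.IsPrincipal.generator I with hpdef
  have hpI : p ∈ I := Submodule.IsPrincipal.generator_mem I
  have hdvd : ∀ f, f ∈ I ↔ p ∣ f := fun f => Submodule.IsPrincipal.mem_iff_generator_dvd I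
  refine ⟨p, le_antisymm (fun v hv => ?_) fun v hv => hU.aeval_eq_zero hu hu0 hpI hv⟩
  rcases eq_or_ne v 0 with rfl | hv0
  · exact U.zero_mem
  rw [LinearMap.mem_ker] at hv
  have hker : LinearMap.ker (polyOrbit g v) = LinearMap.ker (polyOrbit g u) := by
    ext f
    rw [LinearMap.mem_ker, LinearMap.mem_ker, polyOrbit_apply, polyOrbit_apply, ← hI, hdvd]
    constructor
    · intro hf
      by_contra hpf
      obtain ⟨a, b, hab⟩ := (hp.coprime_iff_not_dvd.2 hpf)
      have := congrArg (fun r => Polynomial.aeval (g : V →ₗ[F] V) r v) hab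
      simp [hv, hf] at this
      exact hv0 this.symm
    · rintro ⟨r, rfl⟩
      rw [mul_comm, map_mul, Module.End.mul_apply, hv, map_zero]
  have hfr : finrank F (LinearMap.range (polyOrbit g v)) =
      finrank F (LinearMap.range (polyOrbit g u)) := by
    rw [← (polyOrbit g v).quotKerEquivRange.finrank_eq,
      ← (polyOrbit g u).quotKerEquivRange.finrank_eq, hker]
  have hru : LinearMap.range (polyOrbit g u) = U := by
    refine (hU.eq_bot_or_eq _ ?_ (smul_range_polyOrbit g u)).resolve_left fun h => hu0 ?_
    · rintro _ ⟨f, rfl⟩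
      exact aeval_mem_of_smul_eq hU.smul_eq f hu
    · have := mem_range_polyOrbit g u
      rwa [h, Submodule.mem_bot] at this
  rw [hru] at hfr
  have hle := hU.le_of_finrank_lt (smul_range_polyOrbit g v) (by have := hU.lt; omega)
  rw [Submodule.eq_of_le_of_finrank_eq hle hfr.symm]
  exact mem_range_polyOrbit g v

theorem exists_isCompl (hU : IsFatSubmodule g U) :
    ∃ C : Submodule F V, IsCompl U C ∧ g • C = C := by
  obtain ⟨p, hp⟩ := hU.exists_ker_aeval_eq
  have hd := LinearMap.finrank_range_add_finrank_ker (Polynomial.aeval (g : V →ₗ[F] V) p)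
  rw [hp] at hd
  have hC : g • LinearMap.range (Polynomial.aeval (g : V →ₗ[F] V) p) =
      LinearMap.range (Polynomial.aeval (g : V →ₗ[F] V) p) := by
    refine smul_submodule_eq_of_le (smul_submodule_le_iff.2 ?_) rfl
    rintro _ ⟨v, rfl⟩
    exact ⟨g v, aeval_comm g p v⟩
  refine ⟨_, ?_, hC⟩
  have hdis := ((hU.disjoint_or_le hC).resolve_right fun h => ?_).symm
  · exact Submodule.isCompl_iff_disjoint _ _ (by omega) |>.2 hdis
  · have h1 := Submodule.finrank_mono h
    have := hU.lt
    omega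

theorem le_or_le (hU : IsFatSubmodule g U) {C W : Submodule F V} (hUC : IsCompl U C)
    (hC : g • C = C) (hW : g • W = W) : W ≤ C ∨ U ≤ W := by
  refine (hU.disjoint_or_le hW).imp_left fun h => ?_
  have hd := Submodule.finrank_add_eq_of_isCompl hUC
  have hWU := Submodule.finrank_add_finrank_le_of_disjoint h
  have hlt := hU.lt
  have hsup : g • (W ⊔ C) = W ⊔ C := by rw [Submodule.smul_sup', hW, hC]
  have hsd : finrank F (W ⊔ C : Submodule F V) ≤ finrank F W + finrank F C :=
    Submodule.finrank_add_le_finrank_add_finrank W C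
  rcases hU.disjoint_or_le hsup with h' | h'
  · have h1 := Submodule.finrank_add_finrank_le_of_disjoint h'
    have h2 : C = W ⊔ C := Submodule.eq_of_le_of_finrank_le le_sup_right (by omega)
    rw [h2]
    exact le_sup_left
  · have : W ⊔ C = ⊤ := by
      rw [eq_top_iff, ← hUC.sup_eq_top]
      exact sup_le h' le_sup_right
    rw [this, finrank_top] at hsd
    omega

theorem compl_unique (hU : IsFatSubmodule g U) {C C' : Submodule F V} (hUC : IsCompl U C)
    (hC : g • C = C) (hUC' : IsCompl U C') (hC' : g • C' = C') : C = C' := by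
  have hd := Submodule.finrank_add_eq_of_isCompl hUC
  have hd' := Submodule.finrank_add_eq_of_isCompl hUC'
  rcases hU.le_or_le hUC hC hC' with h | h
  · exact (Submodule.eq_of_le_of_finrank_eq h (by omega)).symm
  · exact absurd (hUC'.disjoint.eq_bot_of_le h) hU.ne_bot

end IsFatSubmodule

section Averaging

variable {E α : Type*} [Group E] [DecidableEq α] [MulAction E α]

open Finset

open scoped Classical in
/-- The elements of a coset of a transitive group have on average at most one fixed point. -/
theorem sum_card_fixed_coset_le [Fintype E] (H : Subgroup E) (Ω : Finset α) (g : E)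
    (hg : ∀ W ∈ Ω, g • W ∈ Ω) (hH : ∀ W ∈ Ω, ∀ W' ∈ Ω, ∃ h ∈ H, h • W = W') :
    ∑ h with h ∈ H, #{W ∈ Ω | (h * g) • W = W} ≤ #{h | h ∈ H} := by
  rcases Ω.eq_empty_or_nonempty with rfl | ⟨W₀, hW₀⟩
  · simp
  simp only [card_filter]
  rw [sum_comm]
  simp only [← card_filter]
  have hcard : ∀ W ∈ Ω, ∀ W' ∈ Ω, #{h ∈ univ.filter (· ∈ H) | h • W = W'} =
      #{h ∈ univ.filter (· ∈ H) | h • W₀ = W₀} := by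
    intro W hW W' hW'
    obtain ⟨a, ha, ha'⟩ := hH W₀ hW₀ W hW
    obtain ⟨b, hb, hb'⟩ := hH W' hW' W₀ hW₀
    refine card_nbij' (fun h => b * h * a) (fun h => b⁻¹ * h * a⁻¹) ?_ ?_ ?_ ?_
    · intro h hh
      simp only [coe_filter, mem_filter, mem_univ, true_and, Set.mem_ofPred_eq] at hh ⊢
      exact ⟨H.mul_mem (H.mul_mem hb hh.1) ha, by rw [mul_smul, mul_smul, ha', hh.2, hb']⟩
    · intro h hh
      simp only [coe_filter, mem_filter, mem_univ, true_and, Set.mem_ofPred_eq] at hh ⊢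
      refine ⟨H.mul_mem (H.mul_mem (H.inv_mem hb) hh.1) (H.inv_mem ha), ?_⟩
      rw [mul_smul, mul_smul, ← ha', inv_smul_smul, hh.2, ← hb', inv_smul_smul]
    · intro h _
      group
    · intro h _
      group
  calc ∑ W ∈ Ω, #{h ∈ univ.filter (· ∈ H) | (h * g) • W = W}
      = ∑ W ∈ Ω, #{h ∈ univ.filter (· ∈ H) | h • W₀ = W} := by
        refine sum_congr rfl fun W hW => ?_
        rw [hcard W₀ hW₀ W hW, ← hcard (g • W) (hg W hW) W hW]
        simp only [mul_smul]
    _ ≤ #{h | h ∈ H} := by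
        rw [← card_biUnion]
        · exact card_le_card (biUnion_subset.2 fun W _ => filter_subset _ _)
        · intro W _ W' _ hne
          refine disjoint_left.2 fun h h1 h2 => hne ?_
          rw [← (mem_filter.1 h1).2, (mem_filter.1 h2).2]

open scoped Classical in
theorem sum_card_fixed_le [Fintype E] (H : Subgroup E) (S : Finset E) (Ω : Finset α)
    (hS : ∀ h ∈ H, ∀ g ∈ S, h * g ∈ S) (hΩ : ∀ g ∈ S, ∀ W ∈ Ω, g • W ∈ Ω)
    (hH : ∀ W ∈ Ω, ∀ W' ∈ Ω, ∃ h ∈ H, h • W = W') :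
    ∑ g ∈ S, #{W ∈ Ω | g • W = W} ≤ #S := by
  have hpos : 0 < #{h | h ∈ H} := card_pos.2 ⟨1, by simp⟩
  refine Nat.le_of_mul_le_mul_left ?_ hpos
  calc #{h | h ∈ H} * ∑ g ∈ S, #{W ∈ Ω | g • W = W}
      = ∑ h with h ∈ H, ∑ g ∈ S, #{W ∈ Ω | (h * g) • W = W} := by
        rw [← smul_eq_mul, ← sum_const]
        refine sum_congr rfl fun h hh => ?_
        have hh' : h ∈ H := (mem_filter.1 hh).2
        refine sum_nbij' (fun g => h⁻¹ * g) (fun g => h * g)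
          (fun g hg => hS _ (H.inv_mem hh') _ hg) (fun g hg => hS _ hh' _ hg)
          (fun g _ => by group) (fun g _ => by group) (fun g _ => by simp)
    _ = ∑ g ∈ S, ∑ h with h ∈ H, #{W ∈ Ω | (h * g) • W = W} := sum_comm
    _ ≤ ∑ g ∈ S, #{h | h ∈ H} :=
        sum_le_sum fun g hg => sum_card_fixed_coset_le H Ω g (hΩ g hg) hH
    _ = #{h | h ∈ H} * #S := by rw [sum_const, smul_eq_mul, mul_comm]

/-- If `S` is a union of conjugacy classes whose elements have on average at most one fixed point
in `Ω`, then pairs in `S × S` have on average at most `1 / #Ω` common fixed points. -/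
theorem card_mul_sum_sq_le (S : Finset E) (Ω : Finset α)
    (hΩ : ∀ W ∈ Ω, ∀ W' ∈ Ω, ∃ h : E, h • W = W' ∧ ∀ g, h * g * h⁻¹ ∈ S ↔ g ∈ S)
    (hS : ∑ g ∈ S, #{W ∈ Ω | g • W = W} ≤ #S) :
    #Ω * ∑ W ∈ Ω, #{g ∈ S | g • W = W} ^ 2 ≤ #S ^ 2 := by
  have hswap : ∑ W ∈ Ω, #{g ∈ S | g • W = W} = ∑ g ∈ S, #{W ∈ Ω | g • W = W} := by
    simp only [card_filter]
    exact sum_comm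
  have hconst : ∀ W ∈ Ω, ∀ W' ∈ Ω, #{g ∈ S | g • W = W} = #{g ∈ S | g • W' = W'} := by
    intro W hW W' hW'
    obtain ⟨h, hh, hS'⟩ := hΩ W hW W' hW'
    refine card_nbij' (fun g => h * g * h⁻¹) (fun g => h⁻¹ * g * h) ?_ ?_ ?_ ?_
    · intro g hg
      simp only [coe_filter, Set.mem_ofPred_eq] at hg ⊢
      exact ⟨(hS' g).2 hg.1, by rw [← hh, mul_smul, mul_smul, inv_smul_smul, hg.2]⟩
    · intro g hg
      simp only [coe_filter, Set.mem_ofPred_eq] at hg ⊢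
      refine ⟨(hS' _).1 ?_, by rw [mul_smul, mul_smul, hh, hg.2, ← hh, inv_smul_smul]⟩
      have : h * (h⁻¹ * g * h) * h⁻¹ = g := by group
      rw [this]
      exact hg.1
    · intro g _
      group
    · intro g _
      group
  have hle : ∀ W ∈ Ω, #Ω * #{g ∈ S | g • W = W} ≤ #S := by
    intro W hW
    rw [← smul_eq_mul, ← sum_const, sum_congr rfl (hconst W hW), hswap]
    exact hS
  calc #Ω * ∑ W ∈ Ω, #{g ∈ S | g • W = W} ^ 2
      = ∑ W ∈ Ω, (#Ω * #{g ∈ S | g • W = W}) * #{g ∈ S | g • W = W} := by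
        rw [mul_sum]
        exact sum_congr rfl fun W _ => by ring
    _ ≤ ∑ W ∈ Ω, #S * #{g ∈ S | g • W = W} :=
        sum_le_sum fun W hW => Nat.mul_le_mul_right _ (hle W hW)
    _ ≤ #S ^ 2 := by
        rw [← mul_sum, hswap, sq]
        exact Nat.mul_le_mul_left _ hS

end Averaging

theorem IsFatSubmodule.mul [FiniteDimensional F V] {g h : V ≃ₗ[F] V} {U : Submodule F V}
    (hU : IsFatSubmodule g U) (hh : ∀ u ∈ U, h u = u) : IsFatSubmodule (h * g) U := by
  have hle : ∀ W ≤ U, h • W = W := fun W hW =>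
    smul_submodule_eq_of_le (smul_submodule_le_iff.2 fun w hw => by rwa [hh w (hW hw)]) rfl
  refine ⟨hU.ne_bot, by rw [mul_smul, hU.smul_eq, hle U le_rfl], fun W hW hgW => ?_, hU.lt⟩
  refine hU.eq_bot_or_eq W hW ?_
  have hgU : g • W ≤ U := by
    rw [← hU.smul_eq]
    exact smul_submodule_le_iff.2 fun w hw => Submodule.smul_mem_pointwise_smul w g U (hW hw)
  rwa [mul_smul, hle _ hgU] at hgW

theorem IsFatSubmodule.conj [FiniteDimensional F V] {g : V ≃ₗ[F] V} {U : Submodule F V}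
    (hU : IsFatSubmodule g U) (h : V ≃ₗ[F] V) : IsFatSubmodule (h * g * h⁻¹) (h • U) := by
  refine ⟨fun h0 => hU.ne_bot ?_, ?_, fun W hW hgW => ?_, ?_⟩
  · rw [← Submodule.finrank_eq_zero (R := F), ← finrank_smul_submodule h U, h0, finrank_bot]
  · rw [mul_smul, mul_smul, inv_smul_smul, hU.smul_eq]
  · have hW' : h⁻¹ • W ≤ U := smul_submodule_le_iff.2 fun w hw => by
      obtain ⟨u, hu, rfl⟩ := (Submodule.mem_smul_pointwise_iff_exists _ _ _).1 (hW hw)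
      have : h⁻¹ • h • u = u := inv_smul_smul h u
      exact (this.symm ▸ hu : h⁻¹ • h • u ∈ U)
    have hfix : g • h⁻¹ • W = h⁻¹ • W := by
      conv_rhs => rw [← hgW]
      rw [mul_smul, mul_smul, inv_smul_smul]
    refine (hU.eq_bot_or_eq _ hW' hfix).imp (fun h0 => ?_) fun h0 => ?_
    · rw [← Submodule.finrank_eq_zero (R := F), ← finrank_smul_submodule h⁻¹ W, h0, finrank_bot]
    · rw [← h0, smul_inv_smul]
  · rw [finrank_smul_submodule]
    exact hU.lt

section Counting

open Finset

variable [FiniteDimensional F V] [Fintype (V ≃ₗ[F] V)] [Fintype (Submodule F V)]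

open scoped Classical in
theorem sum_card_fixed_subspaces_le (S : Finset (V ≃ₗ[F] V)) (k : ℕ)
    (hfat : ∀ g ∈ S, ∃ U, IsFatSubmodule g U)
    (hS : ∀ g ∈ S, ∀ h : V ≃ₗ[F] V, LinearEquiv.det h = 1 →
      (∃ U, IsFatSubmodule (h * g) U) → h * g ∈ S) :
    ∑ g ∈ S, #{W ∈ univ.filter (fun W : Submodule F V => finrank F W = k) | g • W = W} ≤ #S := by
  have hex : ∀ g ∈ S, ∃ l : Submodule F V × Submodule F V,
      IsFatSubmodule g l.1 ∧ IsCompl l.1 l.2 ∧ g • l.2 = l.2 := fun g hg => by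
    obtain ⟨U, hU⟩ := hfat g hg
    obtain ⟨C, hC⟩ := hU.exists_isCompl
    exact ⟨(U, C), hU, hC⟩
  choose! ℓ hℓ using hex
  rw [← sum_fiberwise S ℓ, card_eq_sum_card_fiberwise (f := ℓ) (t := univ) (fun _ _ => by simp)]
  refine sum_le_sum fun l _ => ?_
  rcases (S.filter fun g => ℓ g = l).eq_empty_or_nonempty with h0 | ⟨g₀, hg₀⟩
  · rw [h0]; simp
  obtain ⟨U, C⟩ := l
  have hmem : ∀ g ∈ S.filter fun g => ℓ g = (U, C),
      g ∈ S ∧ IsFatSubmodule g U ∧ IsCompl U C ∧ g • C = C := fun g hg => by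
    have := hℓ g (mem_filter.1 hg).1
    rw [(mem_filter.1 hg).2] at this
    exact ⟨(mem_filter.1 hg).1, this⟩
  obtain ⟨-, hU, hUC, -⟩ := hmem g₀ hg₀
  have hlt := hU.lt
  have hd := Submodule.finrank_add_eq_of_isCompl hUC
  let H : Subgroup (V ≃ₗ[F] V) := (LinearEquiv.det (R := F) (M := V)).ker ⊓
    (fixingSubgroup (V ≃ₗ[F] V) (U : Set V) ⊓ MulAction.stabilizer (V ≃ₗ[F] V) C)
  have hH : ∀ h, h ∈ H ↔ LinearEquiv.det h = 1 ∧ (∀ u ∈ U, h u = u) ∧ h • C = C := fun h => by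
    simp only [H, Subgroup.mem_inf, MonoidHom.mem_ker, mem_fixingSubgroup_iff,
      MulAction.mem_stabilizer_iff]
    rfl
  set Ω : Finset (Submodule F V) :=
    univ.filter fun W : Submodule F V => finrank F W = k ∧ (W ≤ C ∨ U ≤ W) with hΩ
  refine le_trans (sum_le_sum fun g hg => card_le_card (t := {W ∈ Ω | g • W = W}) ?_)
    (sum_card_fixed_le H _ Ω ?_ ?_ ?_)
  · intro W hW
    obtain ⟨-, hgU, -, hgC⟩ := hmem g hg
    simp only [hΩ, mem_filter, mem_univ, true_and] at hW ⊢
    exact ⟨⟨hW.1, hgU.le_or_le hUC hgC hW.2⟩, hW.2⟩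
  · intro h hh g hg
    obtain ⟨hgS, hgU, -, hgC⟩ := hmem g hg
    obtain ⟨h1, h2, h3⟩ := (hH h).1 hh
    have hfat' := hgU.mul h2
    have hS' := hS g hgS h h1 ⟨U, hfat'⟩
    refine mem_filter.2 ⟨hS', ?_⟩
    obtain ⟨a1, a2, a3⟩ := hℓ _ hS'
    have hU' := a1.unique hfat'
    rw [hU'] at a2
    exact Prod.ext hU' (hfat'.compl_unique a2 a3 hUC (by rw [mul_smul, hgC, h3]))
  · intro g hg W hW
    obtain ⟨hgS, hgU, -, hgC⟩ := hmem g hg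
    simp only [hΩ, mem_filter, mem_univ, true_and] at hW ⊢
    rw [finrank_smul_submodule]
    refine ⟨hW.1, hW.2.imp (fun h => ?_) fun h => ?_⟩
    · rw [← hgC]
      exact smul_submodule_le_iff.2 fun w hw => Submodule.smul_mem_pointwise_smul w g C (h hw)
    · rw [← hgU.smul_eq]
      exact smul_submodule_le_iff.2 fun w hw => Submodule.smul_mem_pointwise_smul w g W (h hw)
  · intro W hW W' hW'
    simp only [hΩ, mem_filter, mem_univ, true_and] at hW hW'
    rcases hW.2 with h | h <;> rcases hW'.2 with h' | h'
    · obtain ⟨t, ht1, ht2, ht3, ht4⟩ := exists_det_one_smul_eq hUC h h' (hW.1.trans hW'.1.symm)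
      exact ⟨t, (hH t).2 ⟨Units.ext (by rwa [LinearEquiv.coe_det]), ht2, ht3⟩, ht4⟩
    · have := Submodule.finrank_mono h
      have := Submodule.finrank_mono h'
      omega
    · have := Submodule.finrank_mono h
      have := Submodule.finrank_mono h'
      omega
    · have hdec : ∀ Y : Submodule F V, U ≤ Y → Y = U ⊔ C ⊓ Y := fun Y hY => by
        rw [← sup_inf_assoc_of_le C hY, hUC.sup_eq_top, top_inf_eq]
      have hfin : ∀ Y : Submodule F V, U ≤ Y →
          finrank F Y = finrank F U + finrank F (C ⊓ Y : Submodule F V) := fun Y hY => by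
        have h1 := Submodule.finrank_sup_add_finrank_inf_eq U (C ⊓ Y)
        rw [← hdec Y hY, (hUC.disjoint.mono_right inf_le_left).eq_bot, finrank_bot] at h1
        omega
      obtain ⟨t, ht1, ht2, ht3, ht4⟩ := exists_det_one_smul_eq (W := C ⊓ W) (W' := C ⊓ W') hUC
        inf_le_left inf_le_left (by
          have h1 := hfin W h
          have h2 := hfin W' h'
          omega)
      refine ⟨t, (hH t).2 ⟨Units.ext (by rwa [LinearEquiv.coe_det]), ht2, ht3⟩, ?_⟩
      have htU : t • U = U :=
        smul_submodule_eq_of_le (smul_submodule_le_iff.2 fun u hu => by rwa [ht2 u hu]) rfl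
      rw [hdec W h, hdec W' h', Submodule.smul_sup', htU, ht4]

open scoped Classical in
theorem card_mul_sum_sq_subspaces_le (G : Subgroup (V ≃ₗ[F] V))
    (hG : ∀ g : V ≃ₗ[F] V, LinearEquiv.det g = 1 → g ∈ G) (S : Finset (V ≃ₗ[F] V))
    (hS : ∀ g, g ∈ S ↔ g ∈ G ∧ ∃ U, IsFatSubmodule g U) (k : ℕ) :
    #(univ.filter fun W : Submodule F V => finrank F W = k) *
      ∑ W ∈ univ.filter (fun W : Submodule F V => finrank F W = k), #{g ∈ S | g • W = W} ^ 2 ≤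
        #S ^ 2 := by
  refine card_mul_sum_sq_le S _ (fun W hW W' hW' => ?_)
    (sum_card_fixed_subspaces_le S k (fun g hg => ((hS g).1 hg).2) fun g hg h hh hfat =>
      (hS _).2 ⟨G.mul_mem (hG h hh) ((hS g).1 hg).1, hfat⟩)
  simp only [mem_filter, mem_univ, true_and] at hW hW'
  obtain ⟨h, h1, -, -, h4⟩ := exists_det_one_smul_eq (U := (⊥ : Submodule F V)) isCompl_bot_top
    (le_top (a := W)) (le_top (a := W')) (hW.trans hW'.symm)
  have hhG : h ∈ G := hG h (Units.ext (by rwa [LinearEquiv.coe_det]))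
  refine ⟨h, h4, fun g => ?_⟩
  rw [hS, hS]
  refine and_congr ?_ ⟨?_, ?_⟩
  · rw [Subgroup.mul_mem_cancel_right _ (G.inv_mem hhG), Subgroup.mul_mem_cancel_left _ hhG]
  · rintro ⟨U, hU⟩
    have := hU.conj h⁻¹
    rw [show h⁻¹ * (h * g * h⁻¹) * h⁻¹⁻¹ = g by group] at this
    exact ⟨_, this⟩
  · rintro ⟨U, hU⟩
    exact ⟨_, hU.conj h⟩

end Counting

section Grassmannian

variable (F V) [Finite F]

theorem pow_le_natCard_subspaces [FiniteDimensional F V] {k : ℕ} (hk : k ≤ finrank F V) :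
    Nat.card F ^ (k * (finrank F V - k)) ≤ Nat.card {W : Submodule F V // finrank F W = k} := by
  have : Finite V := Module.finite_of_finite F
  let e : ((Fin k → F) × (Fin (finrank F V - k) → F)) ≃ₗ[F] V :=
    LinearEquiv.ofFinrankEq _ _ (by simp; omega)
  have hcard : Nat.card ((Fin k → F) →ₗ[F] (Fin (finrank F V - k) → F)) =
      Nat.card F ^ (k * (finrank F V - k)) := by
    rw [Module.natCard_eq_pow_finrank (K := F), finrank_linearMap]
    simp
  rw [← hcard]
  refine Nat.card_le_card_of_injective (fun f => ⟨f.graph.map (e : _ →ₗ[F] V), ?_⟩) ?_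
  · rw [LinearEquiv.finrank_map_eq, LinearMap.graph_eq_range_prod,
      LinearMap.finrank_range_of_inj fun x y h => congrArg Prod.fst h]
    simp
  · intro f f' h
    have hmap : f.graph.map (e : _ →ₗ[F] V) = f'.graph.map (e : _ →ₗ[F] V) :=
      congrArg Subtype.val h
    have h' : f.graph = f'.graph := Submodule.map_injective_of_injective e.injective hmap
    refine LinearMap.ext fun x => ?_
    have hx : (x, f x) ∈ f.graph := (LinearMap.mem_graph_iff _ _).2 rfl
    rw [h', LinearMap.mem_graph_iff] at hx
    exact hx

theorem natCard_lines :
    Nat.card {W : Submodule F V // finrank F W = 1} =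
      ∑ i ∈ Finset.range (finrank F V), Nat.card F ^ i := by
  rw [← Nat.card_congr (Projectivization.equivSubmodule F V),
    Projectivization.card_of_finrank F V rfl]

theorem natCard_hyperplanes [FiniteDimensional F V] (hd : 1 ≤ finrank F V) :
    Nat.card {W : Submodule F V // finrank F W = finrank F V - 1} =
      ∑ i ∈ Finset.range (finrank F V), Nat.card F ^ i := by
  have h := natCard_lines F (Module.Dual F V)
  rw [Subspace.dual_finrank_eq] at h
  rw [← h]
  refine Nat.card_congr ((Subspace.orderIsoFiniteDimensional (K := F) (V := V)).toEquiv.subtypeEquiv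
    fun W => ?_)
  have := Subspace.finrank_add_finrank_dualAnnihilator_eq W
  change _ ↔ finrank F W.dualAnnihilator = 1
  omega

end Grassmannian

/-- The special linear group contains fat elements: a Singer cycle on a hyperplane,
corrected on a complementary line. -/
theorem exists_isFatSubmodule_det_one [Finite F] [FiniteDimensional F V] (hd : 3 ≤ finrank F V) :
    ∃ g : V ≃ₗ[F] V, LinearEquiv.det g = 1 ∧ ∃ U, IsFatSubmodule g U := by
  obtain ⟨p, hp⟩ := CharP.exists F
  have : Fact p.Prime := ⟨CharP.char_is_prime F p⟩
  have : NeZero (finrank F V - 1) := ⟨by omega⟩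
  let K := FiniteField.Extension F p (finrank F V - 1)
  have hK : finrank F K = finrank F V - 1 := FiniteField.finrank_extension F p _
  obtain ⟨α, hα⟩ := IsCyclic.exists_monoid_generator (α := Kˣ)
  let a : K ≃ₗ[F] K := DistribMulAction.toLinearEquiv F K α
  let b : F ≃ₗ[F] F := DistribMulAction.toLinearEquiv F F (LinearEquiv.det a)⁻¹
  have hb : LinearMap.det (b : F →ₗ[F] F) = ((LinearEquiv.det a)⁻¹ : Fˣ) := by
    rw [LinearMap.det_ring]
    simp [b, Units.smul_def]
  let e : (K × F) ≃ₗ[F] V := LinearEquiv.ofFinrankEq _ _ (by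
    rw [finrank_prod, hK, finrank_self]; omega)
  let g : V ≃ₗ[F] V := e.symm.trans ((a.prodCongr b).trans e)
  let j : K →ₗ[F] V := (e : _ →ₗ[F] V) ∘ₗ LinearMap.inl F K F
  have hj : Function.Injective j := e.injective.comp LinearMap.inl_injective
  have hg : ∀ x, g (j x) = j (α * x) := fun x => by
    simp [g, j, a, b, Units.smul_def]
  have hrank : finrank F (LinearMap.range j) = finrank F V - 1 := by
    rw [LinearMap.finrank_range_of_inj hj, hK]
  refine ⟨g, Units.ext ?_, LinearMap.range j, ?_, ?_, fun W hW hgW => ?_, ?_⟩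
  · have hgl : (g : V →ₗ[F] V) =
        (e : _ →ₗ[F] V) ∘ₗ ((a : K →ₗ[F] K).prodMap (b : F →ₗ[F] F)) ∘ₗ (e.symm : V →ₗ[F] _) := by
      ext x; rfl
    rw [LinearEquiv.coe_det, hgl, LinearMap.det_conj, LinearMap.det_prodMap, hb,
      ← LinearEquiv.coe_det, ← Units.val_mul, mul_inv_cancel]
  · intro h
    rw [h, finrank_bot] at hrank
    omega
  · refine smul_submodule_eq_of_le (smul_submodule_le_iff.2 ?_) rfl
    rintro _ ⟨x, rfl⟩
    exact ⟨_, (hg x).symm⟩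
  · rw [or_iff_not_imp_left]
    intro h0
    obtain ⟨w, hw, hw0⟩ := Submodule.exists_mem_ne_zero_of_ne_bot h0
    obtain ⟨x, rfl⟩ := hW hw
    have hx : x ≠ 0 := fun h => hw0 (by rw [h, map_zero])
    have hpow : ∀ n : ℕ, j ((α : K) ^ n * x) ∈ W := fun n => by
      induction n with
      | zero => simpa using hw
      | succ n ih =>
        have := smul_submodule_le_iff.1 hgW.le _ ih
        rwa [hg, ← mul_assoc, ← pow_succ'] at this
    refine le_antisymm hW ?_
    rintro _ ⟨y, rfl⟩
    rcases eq_or_ne y 0 with rfl | hy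
    · rw [map_zero]; exact W.zero_mem
    obtain ⟨n, hn⟩ := Submonoid.mem_powers_iff _ _ |>.1 (hα (Units.mk0 y hy / Units.mk0 x hx))
    have hn' := congrArg Units.val hn
    rw [Units.val_pow_eq_pow_val, Units.val_div_eq_div_val, Units.val_mk0, Units.val_mk0,
      eq_div_iff hx] at hn'
    rw [← hn']
    exact hpow n
  · omega

theorem mul_succ_le_two_mul_pow {q : ℕ} (hq : 2 ≤ q) (m : ℕ) : m * (q + 1) ≤ 2 * q ^ m := by
  rcases m with _ | m
  · simp
  induction m with
  | zero => simp; omega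
  | succ m ih =>
    rcases m with _ | m
    · norm_num
      nlinarith
    · calc (m + 1 + 1 + 1) * (q + 1) ≤ 2 * ((m + 1 + 1) * (q + 1)) := by nlinarith
        _ ≤ q * (2 * q ^ (m + 1 + 1)) := Nat.mul_le_mul hq ih
        _ = 2 * q ^ (m + 1 + 1 + 1) := by ring

theorem two_div_add_div_lt {q : ℕ} (hq : 2 ≤ q) (m : ℕ) :
    2 / ((q : ℝ) ^ (m + 2) + (q : ℝ) ^ (m + 1) + 1) + m / (q : ℝ) ^ (2 * (m + 1)) <
      2 / (q : ℝ) ^ (m + 2) := by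
  have hq0 : (0 : ℝ) < q := by positivity
  have h1 : 2 / ((q : ℝ) ^ (m + 2) + (q : ℝ) ^ (m + 1) + 1) < 2 / ((q : ℝ) ^ (m + 1) * (q + 1)) := by
    apply div_lt_div_of_pos_left two_pos (by positivity)
    have : (q : ℝ) ^ (m + 1) * (q + 1) = (q : ℝ) ^ (m + 2) + (q : ℝ) ^ (m + 1) := by ring
    linarith
  have h2 : (m : ℝ) * (q + 1) ≤ 2 * (q : ℝ) ^ m := by
    exact_mod_cast mul_succ_le_two_mul_pow hq m
  have h3 : (m : ℝ) / (q : ℝ) ^ (2 * (m + 1)) ≤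
      2 / (q : ℝ) ^ (m + 2) - 2 / ((q : ℝ) ^ (m + 1) * (q + 1)) := by
    have : 2 / (q : ℝ) ^ (m + 2) - 2 / ((q : ℝ) ^ (m + 1) * (q + 1)) =
        (2 * (q : ℝ) ^ m / (q + 1)) / (q : ℝ) ^ (2 * (m + 1)) := by
      field_simp
      ring
    rw [this]
    gcongr
    rwa [le_div_iff₀ (by positivity)]
  linarith

section Main

open Finset

theorem natCard_subspaces_eq [Fintype (Submodule F V)] (k : ℕ) : Nat.card {W : Submodule F V // finrank F W = k} =
    #(univ.filter fun W : Submodule F V => finrank F W = k) := by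
  rw [Nat.card_eq_fintype_card, Fintype.card_subtype]

theorem pow_add_pow_add_one_le_geom_sum (q : ℕ) (m : ℕ) :
    q ^ (m + 2) + q ^ (m + 1) + 1 ≤ ∑ i ∈ range (m + 3), q ^ i := by
  rw [sum_range_succ, sum_range_succ, sum_range_succ']
  have := Nat.zero_le (∑ k ∈ range m, q ^ (k + 1))
  simp only [pow_zero]
  omega

variable [FiniteDimensional F V] [Fintype (Submodule F V)]

open scoped Classical in
theorem card_reducible_pairs_le (S : Finset (V ≃ₗ[F] V)) :
    #((S ×ˢ S).filter fun p : (V ≃ₗ[F] V) × (V ≃ₗ[F] V) =>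
      ∃ W : Submodule F V, W ≠ ⊥ ∧ W ≠ ⊤ ∧ p.1 • W = W ∧ p.2 • W = W) ≤
      ∑ k ∈ Ico 1 (finrank F V), ∑ W ∈ univ.filter (fun W : Submodule F V => finrank F W = k),
        #{g ∈ S | g • W = W} ^ 2 := by
  set P := univ.filter fun W : Submodule F V => W ≠ ⊥ ∧ W ≠ ⊤
  have hfin : ∀ W ∈ P, finrank F W ∈ Ico 1 (finrank F V) := fun W hW => by
    obtain ⟨h0, h1⟩ := (mem_filter.1 hW).2
    exact mem_Ico.2 ⟨Submodule.one_le_finrank_iff.2 h0, Submodule.finrank_lt h1⟩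
  calc _ ≤ #(P.biUnion fun W => {g ∈ S | g • W = W} ×ˢ {g ∈ S | g • W = W}) := by
        refine card_le_card fun p hp => ?_
        obtain ⟨hp, W, h0, h1, h2, h3⟩ := mem_filter.1 hp
        obtain ⟨hp1, hp2⟩ := mem_product.1 hp
        exact mem_biUnion.2 ⟨W, mem_filter.2 ⟨mem_univ _, h0, h1⟩,
          mem_product.2 ⟨mem_filter.2 ⟨hp1, h2⟩, mem_filter.2 ⟨hp2, h3⟩⟩⟩
    _ ≤ ∑ W ∈ P, #{g ∈ S | g • W = W} ^ 2 := by
        refine card_biUnion_le.trans (sum_le_sum fun W _ => ?_)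
        rw [card_product, sq]
    _ = ∑ k ∈ Ico 1 (finrank F V),
        ∑ W ∈ P.filter (fun W : Submodule F V => finrank F W = k), #{g ∈ S | g • W = W} ^ 2 :=
      (sum_fiberwise_of_maps_to hfin _).symm
    _ ≤ _ := sum_le_sum fun k _ => sum_le_sum_of_subset (filter_subset_filter _ (subset_univ _))

open scoped Classical in
theorem card_reducible_pairs_lt [Finite F] [Fintype (V ≃ₗ[F] V)] (hd : 3 ≤ finrank F V) (G : Subgroup (V ≃ₗ[F] V))
    (hG : ∀ g : V ≃ₗ[F] V, LinearEquiv.det g = 1 → g ∈ G) (S : Finset (V ≃ₗ[F] V))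
    (hS : ∀ g, g ∈ S ↔ g ∈ G ∧ ∃ U, IsFatSubmodule g U) :
    (#((S ×ˢ S).filter fun p : (V ≃ₗ[F] V) × (V ≃ₗ[F] V) =>
      ∃ W : Submodule F V, W ≠ ⊥ ∧ W ≠ ⊤ ∧ p.1 • W = W ∧ p.2 • W = W) : ℝ) <
      2 / (Nat.card F : ℝ) ^ (finrank F V - 1) * (#S : ℝ) ^ 2 := by
  obtain ⟨m, hm⟩ : ∃ m, finrank F V = m + 3 := ⟨finrank F V - 3, by omega⟩
  have hq : 2 ≤ Nat.card F := Finite.one_lt_card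
  set q := Nat.card F
  have hq0 : (0 : ℝ) < q := by positivity
  have hspos : (0 : ℝ) < (#S : ℝ) ^ 2 := by
    obtain ⟨g, hg, hgU⟩ := exists_isFatSubmodule_det_one hd
    have : 0 < #S := card_pos.2 ⟨g, (hS g).2 ⟨hG g hg, hgU⟩⟩
    positivity
  set A : ℕ → ℕ := fun k => ∑ W ∈ univ.filter (fun W : Submodule F V => finrank F W = k),
    #{g ∈ S | g • W = W} ^ 2
  have hA : ∀ k, Nat.card {W : Submodule F V // finrank F W = k} * A k ≤ #S ^ 2 := fun k => by
    rw [natCard_subspaces_eq]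
    exact card_mul_sum_sq_subspaces_le G hG S hS k
  have hbound : ∀ k c : ℕ, 0 < c → c ≤ Nat.card {W : Submodule F V // finrank F W = k} →
      (A k : ℝ) ≤ (#S : ℝ) ^ 2 / c := fun k c hc hck => by
    rw [le_div_iff₀ (by positivity), mul_comm]
    exact_mod_cast (Nat.mul_le_mul_right _ hck).trans (hA k)
  have hgeom := pow_add_pow_add_one_le_geom_sum q m
  have h1 := hbound 1 (q ^ (m + 2) + q ^ (m + 1) + 1) (by positivity)
    (by rw [natCard_lines, hm]; exact hgeom)
  have h2 := hbound (m + 2) (q ^ (m + 2) + q ^ (m + 1) + 1) (by positivity) (by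
    have := natCard_hyperplanes F V (by omega)
    rw [hm] at this
    rw [show m + 3 - 1 = m + 2 by omega] at this
    rw [this]
    exact hgeom)
  have h3 : ∑ k ∈ Ico 2 (m + 2), (A k : ℝ) ≤ m * ((#S : ℝ) ^ 2 / (q : ℝ) ^ (2 * (m + 1))) := by
    have : ∀ k ∈ Ico 2 (m + 2), (A k : ℝ) ≤ (#S : ℝ) ^ 2 / (q : ℝ) ^ (2 * (m + 1)) := by
      intro k hk
      obtain ⟨hk2, hkm⟩ := mem_Ico.1 hk
      have := hbound k (q ^ (2 * (m + 1))) (by positivity) (by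
        refine le_trans (Nat.pow_le_pow_right (by omega) ?_)
          (pow_le_natCard_subspaces F V (k := k) (by omega))
        obtain ⟨i, rfl⟩ := Nat.exists_eq_add_of_le hk2
        obtain ⟨j, hj⟩ := Nat.exists_eq_add_of_le (show 2 + i + 1 ≤ m + 2 by omega)
        rw [hm, show m + 3 - (2 + i) = j + 2 by omega, show m = i + j + 1 by omega]
        nlinarith [Nat.zero_le (i * j)])
      exact_mod_cast this
    refine (sum_le_card_nsmul _ _ _ this).trans_eq ?_
    rw [Nat.card_Ico, nsmul_eq_mul, Nat.add_sub_cancel]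
  have hsum : ∑ k ∈ Ico 1 (m + 3), A k = A 1 + (∑ k ∈ Ico 2 (m + 2), A k + A (m + 2)) := by
    rw [sum_eq_sum_Ico_succ_bot (by omega), sum_Ico_succ_top (by omega)]
  have hle := card_reducible_pairs_le S
  rw [hm] at hle
  have hle' := (Nat.cast_le (α := ℝ)).2 (hle.trans_eq hsum)
  push_cast at hle' h1 h2
  rw [hm, show m + 3 - 1 = m + 2 by omega]
  have key := mul_lt_mul_of_pos_right (two_div_add_div_lt hq m) hspos
  refine lt_of_le_of_lt (hle'.trans ?_) key
  refine (add_le_add h1 (add_le_add h3 h2)).trans_eq ?_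
  ring

end Main

section Matrices

variable {d : ℕ}

/-- Invertible matrices as automorphisms of the natural module. -/
noncomputable def glEquiv (F : Type) [Field F] (d : ℕ) :
    GL (Fin d) F ≃* ((Fin d → F) ≃ₗ[F] (Fin d → F)) :=
  Matrix.GeneralLinearGroup.toLin.trans (LinearMap.GeneralLinearGroup.generalLinearEquiv F _)

variable {F : Type} [Field F]

theorem coe_glEquiv (g : GL (Fin d) F) :
    (glEquiv F d g : (Fin d → F) →ₗ[F] (Fin d → F)) =
      Matrix.toLin' (g : Matrix (Fin d) (Fin d) F) := rfl

theorem matInvariant_iff (g : GL (Fin d) F) (W : Submodule F (Fin d → F)) :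
    MatInvariant (g : Matrix (Fin d) (Fin d) F) W ↔ glEquiv F d g • W = W :=
  ⟨fun h => smul_submodule_eq_of_le h rfl, fun h => h.le⟩

theorem det_glEquiv (g : GL (Fin d) F) :
    ((LinearEquiv.det (glEquiv F d g) : Fˣ) : F) = (g : Matrix (Fin d) (Fin d) F).det := by
  rw [LinearEquiv.coe_det, coe_glEquiv, LinearMap.det_toLin']

theorem isFat_iff [Fintype F] [DecidableEq F] (g : GL (Fin d) F) :
    IsFat g ↔ ∃ U, IsFatSubmodule (glEquiv F d g) U := by
  simp only [IsFat, MatIrreducibleOn, matInvariant_iff]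
  refine exists_congr fun U => ⟨fun h => ⟨h.1.1, h.1.2.1, h.1.2.2, ?_⟩,
    fun h => ⟨⟨h.ne_bot, h.smul_eq, h.eq_bot_or_eq⟩, ?_⟩⟩
  · simpa using h.2
  · simpa using h.lt

theorem natCard_pairs_eq {E E' : Type*} [Group E] [Group E'] (φ : E ≃* E') (G : Subgroup E)
    (Q : E → E → Prop) (T : Finset (E' × E'))
    (hT : ∀ a b, (φ a, φ b) ∈ T ↔ a ∈ G ∧ b ∈ G ∧ Q a b) :
    Nat.card {p : G × G // Q p.1 p.2} = T.card := by
  rw [← Nat.card_eq_finsetCard T]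
  refine Nat.card_eq_of_bijective
    (fun p => ⟨(φ p.1.1, φ p.1.2), (hT _ _).2 ⟨p.1.1.2, p.1.2.2, p.2⟩⟩) ⟨fun p p' h => ?_, ?_⟩
  · have h' := congrArg Subtype.val h
    exact Subtype.ext (Prod.ext (Subtype.ext (φ.injective (congrArg Prod.fst h')))
      (Subtype.ext (φ.injective (congrArg Prod.snd h'))))
  · rintro ⟨⟨x, y⟩, hxy⟩
    obtain ⟨a, rfl⟩ := φ.surjective x
    obtain ⟨b, rfl⟩ := φ.surjective y
    obtain ⟨ha, hb, hQ⟩ := (hT a b).1 hxy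
    exact ⟨⟨(⟨a, ha⟩, ⟨b, hb⟩), hQ⟩, rfl⟩

end Matrices

end FatPairs

open scoped Pointwise

/-- Theorem 2: for `SL(d,q) ≤ G ≤ GL(d,q)` with `d ≥ 3`, the proportion of reducible pairs
among the fat pairs in `G × G` is less than `2 q^{-d+1}`. -/
theorem rediffat_lt (q d : ℕ) (hq : IsPrimePow q) (hd : 3 ≤ d)
    (F : Type) [Field F] [Fintype F] [DecidableEq F] (hF : Fintype.card F = q)
    (G : Subgroup (GL (Fin d) F))
    (hG : ∀ g : GL (Fin d) F, (g : Matrix (Fin d) (Fin d) F).det = 1 → g ∈ G) :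
    (Nat.card {p : G × G //
        IsFat (p.1 : GL (Fin d) F) ∧ IsFat (p.2 : GL (Fin d) F) ∧
        IsRedPair (p.1 : GL (Fin d) F) (p.2 : GL (Fin d) F)} : ℝ) <
      2 * (q : ℝ) ^ (-(d : ℤ) + 1) *
        (Nat.card {p : G × G //
          IsFat (p.1 : GL (Fin d) F) ∧ IsFat (p.2 : GL (Fin d) F)} : ℝ) := by
  classical
  have : Finite ((Fin d → F) ≃ₗ[F] (Fin d → F)) := DFunLike.finite _
  have : Fintype ((Fin d → F) ≃ₗ[F] (Fin d → F)) := Fintype.ofFinite _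
  have : Finite (Submodule F (Fin d → F)) := Finite.of_injective _ SetLike.coe_injective
  have : Fintype (Submodule F (Fin d → F)) := Fintype.ofFinite _
  set φ := glEquiv F d
  let S : Finset ((Fin d → F) ≃ₗ[F] (Fin d → F)) :=
    Finset.univ.filter fun g => g ∈ G.map φ.toMonoidHom ∧ ∃ U, IsFatSubmodule g U
  have hS : ∀ g, g ∈ S ↔ g ∈ G.map φ.toMonoidHom ∧ ∃ U, IsFatSubmodule g U := fun g => by
    simp [S]
  have hSφ : ∀ a, φ a ∈ S ↔ a ∈ G ∧ IsFat a := fun a => by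
    rw [hS, isFat_iff]
    exact and_congr_left' (Subgroup.mem_map_iff_mem φ.injective)
  have hSL : ∀ g, LinearEquiv.det g = 1 → g ∈ G.map φ.toMonoidHom := fun g hg => by
    obtain ⟨a, rfl⟩ := φ.surjective g
    refine Subgroup.mem_map_of_mem _ (hG a ?_)
    rw [← det_glEquiv, hg, Units.val_one]
  have hmain := card_reducible_pairs_lt (by simpa using hd) _ hSL S hS
  rw [natCard_pairs_eq φ G (fun a b => IsFat a ∧ IsFat b ∧ IsRedPair a b)
      ((S ×ˢ S).filter fun p => ∃ W : Submodule F (Fin d → F),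
        W ≠ ⊥ ∧ W ≠ ⊤ ∧ p.1 • W = W ∧ p.2 • W = W) (fun a b => by
        simp only [Finset.mem_filter, Finset.mem_product, hSφ, IsRedPair, matInvariant_iff]
        tauto),
    natCard_pairs_eq φ G (fun a b => IsFat a ∧ IsFat b) (S ×ˢ S) (fun a b => by
        simp only [Finset.mem_product, hSφ]
        tauto)]
  refine hmain.trans_eq ?_
  rw [Module.finrank_fin_fun, Nat.card_eq_fintype_card, hF, Finset.card_product, Nat.cast_mul, sq,
    show (-(d : ℤ) + 1) = -((d - 1 : ℕ) : ℤ) by omega, zpow_neg, zpow_natCast, div_eq_mul_inv]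
end
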